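/- arXiv:2209.07772 — 2 statements merged into one kernel-verified Lean document; each statement's English description precedes it below -/
import Mathlib

section
/- In the constructed graph H, the set of vertices of degree at least k − 1 is exactly {s*} ∪ V(G) ∪ Q ∪ A ∪ X, and this set has size 2W + 4m + n + 2 = k + m. -/
open Finset

/-- `a` is a b-vertex of the coloring `c`: it has a neighbor in every color class
other than its own. -/
def IsBVertex {VH : Type*} (H : SimpleGraph VH) {k : ℕ} (c : VH → Fin k) (a : VH) : Prop :=
  ∀ col : Fin k, col ≠ c a → ∃ b : VH, H.Adj a b ∧ c b = col

/-- `c` is a b-coloring of `H` with `k` colors: a proper coloring using all `k` colors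
in which every color class contains a b-vertex. -/
def IsBColoring {VH : Type*} (H : SimpleGraph VH) (k : ℕ) (c : VH → Fin k) : Prop :=
  (∀ ⦃a b : VH⦄, H.Adj a b → c a ≠ c b) ∧ Function.Surjective c ∧
    ∀ col : Fin k, ∃ a : VH, c a = col ∧ IsBVertex H c a

variable {V : Type*} [Fintype V] [DecidableEq V]

/-- `W`, the total weight of all edges. -/
def totW (G : SimpleGraph V) [DecidableRel G.Adj] (wt : Sym2 V → ℕ) : ℕ :=
  ∑ e ∈ G.edgeFinset, wt e

/-- `W_v`, the total weight of the edges incident with `v`. -/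
def vertW (G : SimpleGraph V) [DecidableRel G.Adj] (wt : Sym2 V → ℕ) (v : V) : ℕ :=
  ∑ e ∈ G.edgeFinset.filter (fun e => v ∈ e), wt e

/-- `k = 2W + 3m + n + 2`. -/
def numColors (G : SimpleGraph V) [DecidableRel G.Adj] (wt : Sym2 V → ℕ) : ℕ :=
  2 * totW G wt + 3 * G.edgeFinset.card + Fintype.card V + 2

/-- An orientation of `(G, wt)` (given by choosing a head `o e ∈ e` for every edge `e`)
is circulating if, at every vertex, the entering weight equals the leaving weight. -/
def IsCirculating (G : SimpleGraph V) [DecidableRel G.Adj] (wt : Sym2 V → ℕ)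
    (o : Sym2 V → V) : Prop :=
  (∀ e ∈ G.edgeFinset, o e ∈ e) ∧
    ∀ v : V,
      ∑ e ∈ G.edgeFinset.filter (fun e => v ∈ e ∧ o e = v), wt e =
        ∑ e ∈ G.edgeFinset.filter (fun e => v ∈ e ∧ o e ≠ v), wt e

/-- The data of the construction of the graph `H` from `(G, wt)`. -/
structure GadgetData (V : Type*) [Fintype V] [DecidableEq V]
    (G : SimpleGraph V) [DecidableRel G.Adj] (wt : Sym2 V → ℕ) where
  /-- the vertex type of `H` -/
  VH : Type*
  fintypeVH : Fintype VH
  decEqVH : DecidableEq VH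
  /-- the graph `H` -/
  H : SimpleGraph VH
  decAdj : DecidableRel H.Adj
  /-- the center `s*` of the superstar -/
  sstar : VH
  /-- the leaves of the superstar -/
  Sleaves : Finset VH
  /-- the centers of the anonymous stars -/
  Acenters : Finset VH
  /-- the leaves of each anonymous star -/
  Aleaves : VH → Finset VH
  /-- the sets `L_{e,v}` (subsets of the superstar leaves) -/
  L : Sym2 V → V → Finset VH
  /-- the copy of a vertex of `G` inside `H` -/
  orig : V → VH
  /-- the sets `P_v` -/
  P : V → Finset VH
  /-- the vertices `x_{e,v}` -/
  x : Sym2 V → V → VH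
  /-- the sets `Y_e` -/
  Y : Sym2 V → Finset VH
  /-- the sets `Z_e` -/
  Z : Sym2 V → Finset VH
  /-- the vertices `q_{e,1}, q_{e,2}` -/
  q : Sym2 V → Fin 2 → VH

namespace GadgetData

variable {G : SimpleGraph V} [DecidableRel G.Adj] {wt : Sym2 V → ℕ}

/-- The set `X = {x_{e,v} : v ∈ e ∈ E(G)}`. -/
def Xset (g : GadgetData V G wt) : Finset g.VH :=
  letI := g.fintypeVH; letI := g.decEqVH
  G.edgeFinset.biUnion fun e => (Finset.univ.filter fun v => v ∈ e).image (g.x e)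

/-- The set `Q = {q_{e,1}, q_{e,2} : e ∈ E(G)}`. -/
def Qset (g : GadgetData V G wt) : Finset g.VH :=
  letI := g.decEqVH
  G.edgeFinset.biUnion fun e => {g.q e 0, g.q e 1}

/-- The parts into which the vertex set of `H` is partitioned. -/
def parts (g : GadgetData V G wt) : List (Finset g.VH) :=
  letI := g.fintypeVH; letI := g.decEqVH
  [{g.sstar}, g.Sleaves, g.Acenters, g.Acenters.biUnion g.Aleaves,
    Finset.univ.image g.orig, Finset.univ.biUnion g.P,
    g.Xset, G.edgeFinset.biUnion g.Y, G.edgeFinset.biUnion g.Z, g.Qset]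

/-- One directional specification of the adjacencies of `H`. -/
def AdjSpec (g : GadgetData V G wt) (a b : g.VH) : Prop :=
  (a = g.sstar ∧ b ∈ g.Sleaves) ∨
  (∃ s ∈ g.Acenters, a = s ∧ b ∈ g.Aleaves s) ∨
  (∃ v : V, a = g.orig v ∧ b ∈ g.P v) ∨
  (∃ e ∈ G.edgeFinset, ∃ v : V, v ∈ e ∧ a = g.orig v ∧ (b ∈ g.L e v ∨ b ∈ g.Y e)) ∨
  (∃ e ∈ G.edgeFinset, ∃ v : V, v ∈ e ∧ a = g.x e v ∧
    (b ∈ g.Y e ∨ b ∈ g.Z e ∨ b ∈ g.L e v)) ∨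
  (∃ e ∈ G.edgeFinset, a = g.q e 0 ∧ b = g.q e 1) ∨
  (∃ e ∈ G.edgeFinset, ∃ h : Fin 2, a = g.q e h ∧
    (b ∈ g.Z e ∨ (∃ v : V, v ∈ e ∧ b ∈ g.L e v) ∨ (∃ v : V, v ∈ e ∧ b = g.x e v)))

/-- Degree in `H`. -/
def deg (g : GadgetData V G wt) (a : g.VH) : ℕ :=
  letI := g.fintypeVH; letI := g.decEqVH; letI := g.decAdj
  g.H.degree a

/-- The set `{s*} ∪ V(G) ∪ Q ∪ A ∪ X`. -/
def bigSet (g : GadgetData V G wt) : Finset g.VH :=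
  letI := g.fintypeVH; letI := g.decEqVH
  {g.sstar} ∪ Finset.univ.image g.orig ∪ g.Qset ∪ g.Acenters ∪ g.Xset

end GadgetData

/-- The construction of the graph `H` from `(G, wt)`: the data together with all the
requirements (sizes of the parts, their disjointness, and the adjacency relation). -/
structure Gadget (V : Type*) [Fintype V] [DecidableEq V]
    (G : SimpleGraph V) [DecidableRel G.Adj] (wt : Sym2 V → ℕ)
    extends GadgetData V G wt where
  card_Sleaves : Sleaves.card = numColors G wt - 1
  card_Acenters : Acenters.card = 2 * totW G wt + 1
  card_Aleaves : ∀ s ∈ Acenters, (Aleaves s).card = numColors G wt - 1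
  Aleaves_disjoint : ∀ s ∈ Acenters, ∀ s' ∈ Acenters, s ≠ s' →
    Disjoint (Aleaves s) (Aleaves s')
  L_subset : ∀ e ∈ G.edgeFinset, ∀ v ∈ e, L e v ⊆ Sleaves
  card_L : ∀ e ∈ G.edgeFinset, ∀ v ∈ e, (L e v).card = wt e
  L_disjoint : ∀ e ∈ G.edgeFinset, ∀ v ∈ e, ∀ e' ∈ G.edgeFinset, ∀ v' ∈ e',
    (e, v) ≠ (e', v') → Disjoint (L e v) (L e' v')
  card_P : ∀ v : V, 2 * (P v).card + 3 * vertW G wt v + 2 = 2 * numColors G wt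
  card_Y : ∀ e ∈ G.edgeFinset, (Y e).card = wt e
  card_Z : ∀ e ∈ G.edgeFinset, (Z e).card + 2 * wt e + 3 = numColors G wt
  orig_inj : Function.Injective orig
  P_disjoint : ∀ v v' : V, v ≠ v' → Disjoint (P v) (P v')
  x_inj : ∀ e ∈ G.edgeFinset, ∀ v ∈ e, ∀ e' ∈ G.edgeFinset, ∀ v' ∈ e',
    x e v = x e' v' → (e, v) = (e', v')
  Y_disjoint : ∀ e ∈ G.edgeFinset, ∀ e' ∈ G.edgeFinset, e ≠ e' → Disjoint (Y e) (Y e')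
  Z_disjoint : ∀ e ∈ G.edgeFinset, ∀ e' ∈ G.edgeFinset, e ≠ e' → Disjoint (Z e) (Z e')
  q_inj : ∀ e ∈ G.edgeFinset, ∀ h : Fin 2, ∀ e' ∈ G.edgeFinset, ∀ h' : Fin 2,
    q e h = q e' h' → (e, h) = (e', h')
  parts_disjoint : toGadgetData.parts.Pairwise Disjoint
  parts_cover : ∀ a : VH, ∃ p ∈ toGadgetData.parts, a ∈ p
  adj_iff : ∀ a b : VH, H.Adj a b ↔
    toGadgetData.AdjSpec a b ∨ toGadgetData.AdjSpec b a

namespace GadgetData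

variable {G : SimpleGraph V} [DecidableRel G.Adj] {wt : Sym2 V → ℕ}

instance (g : GadgetData V G wt) : DecidableEq g.VH := g.decEqVH

theorem card_le_deg (g : GadgetData V G wt) {a : g.VH} {s : Finset g.VH}
    (h : ∀ b ∈ s, g.H.Adj a b) : s.card ≤ g.deg a := by
  let := g.fintypeVH
  let := g.decAdj
  rw [deg, ← SimpleGraph.card_neighborFinset_eq_degree]
  exact card_le_card fun b hb => by simpa using h b hb

theorem deg_le_card (g : GadgetData V G wt) {a : g.VH} {s : Finset g.VH}
    (h : ∀ b, g.H.Adj a b → b ∈ s) : g.deg a ≤ s.card := by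
  let := g.fintypeVH
  let := g.decAdj
  rw [deg, ← SimpleGraph.card_neighborFinset_eq_degree]
  exact card_le_card fun b hb => h b (by simpa using hb)

end GadgetData

namespace Gadget

variable {G : SimpleGraph V} [DecidableRel G.Adj] {wt : Sym2 V → ℕ}

/-- `t` assigns to every vertex of `H` the index of its part. -/
structure IsPartIndex (g : Gadget V G wt) (t : g.VH → ℕ) : Prop where
  sstar : t g.sstar = 0
  Sleaves : ∀ a ∈ g.Sleaves, t a = 1
  Acenters : ∀ a ∈ g.Acenters, t a = 2
  Aleaves : ∀ s ∈ g.Acenters, ∀ a ∈ g.Aleaves s, t a = 3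
  orig : ∀ v, t (g.orig v) = 4
  P : ∀ v, ∀ a ∈ g.P v, t a = 5
  x : ∀ e ∈ G.edgeFinset, ∀ v ∈ e, t (g.x e v) = 6
  Y : ∀ e ∈ G.edgeFinset, ∀ a ∈ g.Y e, t a = 7
  Z : ∀ e ∈ G.edgeFinset, ∀ a ∈ g.Z e, t a = 8
  q : ∀ e ∈ G.edgeFinset, ∀ h, t (g.q e h) = 9
  L : ∀ e ∈ G.edgeFinset, ∀ v ∈ e, ∀ a ∈ g.L e v, t a = 1

theorem exists_isPartIndex (g : Gadget V G wt) : ∃ t, g.IsPartIndex t := by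
  let := g.fintypeVH
  have hidx : ∀ a : g.VH, ∃ i, ∃ h : i < g.parts.length, a ∈ g.parts[i] := fun a => by
    obtain ⟨p, hp, ha⟩ := g.parts_cover a
    obtain ⟨i, hi, rfl⟩ := List.getElem_of_mem hp
    exact ⟨i, hi, ha⟩
  choose t ht hat using hidx
  have key : ∀ i (h : i < g.parts.length), ∀ a ∈ g.parts[i], t a = i := by
    intro i h a ha
    have hpw := List.pairwise_iff_getElem.1 g.parts_disjoint
    rcases lt_trichotomy (t a) i with hlt | heq | hlt
    · exact absurd ha (disjoint_left.1 (hpw _ _ (ht a) h hlt) (hat a))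
    · exact heq
    · exact absurd (hat a) (disjoint_left.1 (hpw _ _ h (ht a) hlt) ha)
  have hS : ∀ a ∈ g.Sleaves, t a = 1 := key 1 (by simp [GadgetData.parts])
  refine ⟨t, key 0 (by simp [GadgetData.parts]) _ (mem_singleton_self _), hS,
    key 2 (by simp [GadgetData.parts]),
    fun s hs a ha => key 3 (by simp [GadgetData.parts]) a (mem_biUnion.2 ⟨s, hs, ha⟩),
    fun v => key 4 (by simp [GadgetData.parts]) _ (mem_image_of_mem _ (mem_univ v)),
    fun v a ha => key 5 (by simp [GadgetData.parts]) a (mem_biUnion.2 ⟨v, mem_univ v, ha⟩),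
    fun e he v hv => key 6 (by simp [GadgetData.parts]) _
      (mem_biUnion.2 ⟨e, he, mem_image_of_mem _ (by simpa using hv)⟩),
    fun e he a ha => key 7 (by simp [GadgetData.parts]) a (mem_biUnion.2 ⟨e, he, ha⟩),
    fun e he a ha => key 8 (by simp [GadgetData.parts]) a (mem_biUnion.2 ⟨e, he, ha⟩),
    fun e he h => key 9 (by simp [GadgetData.parts]) _ (mem_biUnion.2 ⟨e, he, ?_⟩),
    fun e he v hv a ha => hS a (g.L_subset e he v hv ha)⟩
  fin_cases h <;> simp

theorem le_deg_of_mem_bigSet (g : Gadget V G wt) {a : g.VH} (ha : a ∈ g.bigSet) :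
    numColors G wt - 1 ≤ g.deg a := by
  let := g.fintypeVH
  obtain ⟨t, ht⟩ := g.exists_isPartIndex
  obtain rfl | ⟨v, rfl⟩ | ha | ha | ha : a = g.sstar ∨ (∃ v, g.orig v = a) ∨ a ∈ g.Qset ∨
      a ∈ g.Acenters ∨ a ∈ g.Xset := by
    simpa [GadgetData.bigSet, or_assoc] using ha
  · rw [← g.card_Sleaves]
    exact g.card_le_deg fun b hb => (g.adj_iff _ _).2 (.inl (.inl ⟨rfl, hb⟩))
  · have hcard : (g.P v ∪ (G.edgeFinset.filter (v ∈ ·)).biUnion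
        fun e => g.L e v ∪ g.Y e).card = (g.P v).card + 2 * vertW G wt v := by
      rw [card_union_of_disjoint, card_biUnion, vertW, mul_sum]
      · congr 1
        refine sum_congr rfl fun e he => ?_
        obtain ⟨he, hv⟩ := mem_filter.1 he
        rw [card_union_of_disjoint, g.card_L e he v hv, g.card_Y e he, two_mul]
        refine disjoint_left.2 fun b hb hb' => ?_
        have := ht.L e he v hv b hb
        have := ht.Y e he b hb'
        omega
      · intro e he e' he' hne
        obtain ⟨he, hv⟩ := mem_filter.1 he
        obtain ⟨he', hv'⟩ := mem_filter.1 he'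
        refine disjoint_left.2 fun b hb hb' => ?_
        rcases mem_union.1 hb with hb | hb <;> rcases mem_union.1 hb' with hb' | hb'
        · exact disjoint_left.1 (g.L_disjoint e he v hv e' he' v hv' (by simp [hne])) hb hb'
        · have := ht.L e he v hv b hb
          have := ht.Y e' he' b hb'
          omega
        · have := ht.L e' he' v hv' b hb'
          have := ht.Y e he b hb
          omega
        · exact disjoint_left.1 (g.Y_disjoint e he e' he' hne) hb hb'
      · refine disjoint_left.2 fun b hb hb' => ?_
        obtain ⟨e, he, hb'⟩ := mem_biUnion.1 hb'
        obtain ⟨he, hv⟩ := mem_filter.1 he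
        have := ht.P v b hb
        rcases mem_union.1 hb' with hb' | hb'
        · have := ht.L e he v hv b hb'
          omega
        · have := ht.Y e he b hb'
          omega
    have hP := g.card_P v
    have hle := hcard ▸ g.card_le_deg (a := g.orig v) fun b hb => by
      refine (g.adj_iff _ _).2 (.inl ?_)
      rcases mem_union.1 hb with hb | hb
      · exact .inr (.inr (.inl ⟨v, rfl, hb⟩))
      · obtain ⟨e, he, hb⟩ := mem_biUnion.1 hb
        obtain ⟨he, hv⟩ := mem_filter.1 he
        exact .inr (.inr (.inr (.inl ⟨e, he, v, hv, rfl, mem_union.1 hb⟩)))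
    omega
  · obtain ⟨e, he, ha⟩ := mem_biUnion.1 ha
    obtain ⟨h, rfl⟩ : ∃ h, a = g.q e h := by
      rcases mem_insert.1 ha with ha | ha
      · exact ⟨0, ha⟩
      · exact ⟨1, mem_singleton.1 ha⟩
    obtain ⟨u, v, rfl⟩ : ∃ u v, e = s(u, v) := by
      induction e with | _ u v => exact ⟨u, v, rfl⟩
    have hne : u ≠ v := G.ne_of_adj (by simpa using he)
    have hu : u ∈ s(u, v) := Sym2.mem_mk_left u v
    have hv : v ∈ s(u, v) := Sym2.mem_mk_right u v
    have hx : g.x s(u, v) u ≠ g.x s(u, v) v := fun h => hne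
      (congrArg Prod.snd (g.x_inj _ he _ hu _ he _ hv h))
    have hcard : (g.Z s(u, v) ∪ (g.L s(u, v) u ∪
        (g.L s(u, v) v ∪ {g.x s(u, v) u, g.x s(u, v) v}))).card =
        (g.Z s(u, v)).card + (wt s(u, v) + (wt s(u, v) + 2)) := by
      have hLx : ∀ w ∈ s(u, v), ∀ b ∈ g.L s(u, v) w,
          b ∉ ({g.x s(u, v) u, g.x s(u, v) v} : Finset g.VH) := by
        intro w hw b hb hb'
        have := ht.L _ he w hw b hb
        have := ht.x _ he u hu
        have := ht.x _ he v hv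
        simp only [mem_insert, mem_singleton] at hb'
        grind
      rw [card_union_of_disjoint, card_union_of_disjoint, card_union_of_disjoint,
        g.card_L _ he _ hu, g.card_L _ he _ hv, card_pair hx]
      · exact disjoint_left.2 (hLx v hv)
      · exact disjoint_union_right.2 ⟨g.L_disjoint _ he _ hu _ he _ hv (by simp [hne]),
          disjoint_left.2 (hLx u hu)⟩
      · refine disjoint_left.2 fun b hb hb' => ?_
        have := ht.Z _ he b hb
        have := ht.L _ he u hu b
        have := ht.L _ he v hv b
        have := ht.x _ he u hu
        have := ht.x _ he v hv
        simp only [mem_union, mem_insert, mem_singleton] at hb'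
        grind
    have hZ := g.card_Z _ he
    have hle := hcard ▸ g.card_le_deg (a := g.q s(u, v) h) fun b hb => by
      refine (g.adj_iff _ _).2 (.inl (.inr (.inr (.inr (.inr (.inr (.inr
        ⟨s(u, v), he, h, rfl, ?_⟩)))))))
      simp only [mem_union, mem_insert, mem_singleton] at hb
      rcases hb with hb | hb | hb | hb | hb
      · exact .inl hb
      · exact .inr (.inl ⟨u, hu, hb⟩)
      · exact .inr (.inl ⟨v, hv, hb⟩)
      · exact .inr (.inr ⟨u, hu, hb⟩)
      · exact .inr (.inr ⟨v, hv, hb⟩)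
    omega
  · rw [← g.card_Aleaves a ha]
    exact g.card_le_deg fun b hb => (g.adj_iff _ _).2 (.inl (.inr (.inl ⟨a, ha, rfl, hb⟩)))
  · obtain ⟨e, he, ha⟩ := mem_biUnion.1 ha
    obtain ⟨v, hv, rfl⟩ := mem_image.1 ha
    replace hv : v ∈ e := by simpa using hv
    have hq : g.q e 0 ≠ g.q e 1 := fun h => by
      simpa using g.q_inj _ he _ _ he _ h
    have hcard : (g.Y e ∪ (g.Z e ∪ (g.L e v ∪ {g.q e 0, g.q e 1}))).card =
        wt e + ((g.Z e).card + (wt e + 2)) := by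
      have hY := ht.Y e he
      have hZ := ht.Z e he
      have hL := ht.L e he v hv
      have hq0 := ht.q e he 0
      have hq1 := ht.q e he 1
      rw [card_union_of_disjoint, card_union_of_disjoint, card_union_of_disjoint,
        g.card_L _ he _ hv, g.card_Y e he, card_pair hq] <;>
      · refine disjoint_left.2 fun b hb hb' => ?_
        simp only [mem_union, mem_insert, mem_singleton] at hb'
        grind
    have hZ := g.card_Z _ he
    have hle := hcard ▸ g.card_le_deg (a := g.x e v) fun b hb => by
      refine (g.adj_iff _ _).2 ?_
      simp only [mem_union, mem_insert, mem_singleton] at hb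
      rcases hb with hb | hb | hb | hb | hb
      · exact .inl (.inr (.inr (.inr (.inr (.inl ⟨e, he, v, hv, rfl, .inl hb⟩)))))
      · exact .inl (.inr (.inr (.inr (.inr (.inl ⟨e, he, v, hv, rfl, .inr (.inl hb)⟩)))))
      · exact .inl (.inr (.inr (.inr (.inr (.inl ⟨e, he, v, hv, rfl, .inr (.inr hb)⟩)))))
      · exact .inr (.inr (.inr (.inr (.inr (.inr (.inr
          ⟨e, he, 0, hb, .inr (.inr ⟨v, hv, rfl⟩)⟩))))))
      · exact .inr (.inr (.inr (.inr (.inr (.inr (.inr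
          ⟨e, he, 1, hb, .inr (.inr ⟨v, hv, rfl⟩)⟩))))))
    omega

theorem IsPartIndex.mem_of_adjSpec {g : Gadget V G wt} {t : g.VH → ℕ} (ht : g.IsPartIndex t)
    {a b : g.VH} (h : g.AdjSpec a b) : t a = 0 ∨ t a = 2 ∨ t a = 4 ∨ t a = 6 ∨ t a = 9 := by
  rcases h with ⟨rfl, -⟩ | ⟨s, hs, rfl, -⟩ | ⟨v, rfl, -⟩ | ⟨e, he, v, hv, rfl, -⟩ |
    ⟨e, he, v, hv, rfl, -⟩ | ⟨e, he, rfl, -⟩ | ⟨e, he, h, rfl, -⟩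
  · exact .inl ht.sstar
  · exact .inr (.inl (ht.Acenters _ hs))
  · exact .inr (.inr (.inl (ht.orig v)))
  · exact .inr (.inr (.inl (ht.orig v)))
  · exact .inr (.inr (.inr (.inl (ht.x e he v hv))))
  · exact .inr (.inr (.inr (.inr (ht.q e he 0))))
  · exact .inr (.inr (.inr (.inr (ht.q e he h))))

theorem IsPartIndex.adj_iff_adjSpec {g : Gadget V G wt} {t : g.VH → ℕ} (ht : g.IsPartIndex t)
    {a b : g.VH} (ha : t a = 1 ∨ t a = 3 ∨ t a = 5 ∨ t a = 7 ∨ t a = 8) :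
    g.H.Adj a b ↔ g.AdjSpec b a :=
  (g.adj_iff a b).trans (or_iff_right fun h => by have := ht.mem_of_adjSpec h; omega)

theorem deg_le_one_of_mem_Aleaves (g : Gadget V G wt) {s a : g.VH} (hs : s ∈ g.Acenters)
    (ha : a ∈ g.Aleaves s) : g.deg a ≤ 1 := by
  obtain ⟨t, ht⟩ := g.exists_isPartIndex
  have hta := ht.Aleaves s hs a ha
  refine (g.deg_le_card (s := {s}) fun b hb => ?_).trans (card_singleton s).le
  have hu : ∀ s' ∈ g.Acenters, a ∈ g.Aleaves s' → s' = s := fun s' hs' ha' =>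
    by_contra fun hne => disjoint_left.1 (g.Aleaves_disjoint s' hs' s hs hne) ha' ha
  rw [ht.adj_iff_adjSpec (by omega)] at hb
  cases ht
  rcases hb with ⟨rfl, h⟩ | ⟨s', hs', rfl, h⟩ | ⟨v', rfl, h⟩ | ⟨e', he', v', hv', rfl, h | h⟩ |
    ⟨e', he', v', hv', rfl, h | h | h⟩ | ⟨e', he', rfl, h⟩ |
    ⟨e', he', i, rfl, h | ⟨v', hv', h⟩ | ⟨v', hv', h⟩⟩ <;> grind

theorem deg_le_one_of_mem_P (g : Gadget V G wt) {v : V} {a : g.VH} (ha : a ∈ g.P v) :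
    g.deg a ≤ 1 := by
  obtain ⟨t, ht⟩ := g.exists_isPartIndex
  have hta := ht.P v a ha
  refine (g.deg_le_card (s := {g.orig v}) fun b hb => ?_).trans (card_singleton _).le
  have hu : ∀ v', a ∈ g.P v' → v' = v := fun v' ha' =>
    by_contra fun hne => disjoint_left.1 (g.P_disjoint v' v hne) ha' ha
  rw [ht.adj_iff_adjSpec (by omega)] at hb
  cases ht
  rcases hb with ⟨rfl, h⟩ | ⟨s', hs', rfl, h⟩ | ⟨v', rfl, h⟩ | ⟨e', he', v', hv', rfl, h | h⟩ |
    ⟨e', he', v', hv', rfl, h | h | h⟩ | ⟨e', he', rfl, h⟩ |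
    ⟨e', he', i, rfl, h | ⟨v', hv', h⟩ | ⟨v', hv', h⟩⟩ <;> grind

theorem deg_le_four_of_mem_Y (g : Gadget V G wt) {e : Sym2 V} (he : e ∈ G.edgeFinset)
    {a : g.VH} (ha : a ∈ g.Y e) : g.deg a ≤ 4 := by
  obtain ⟨t, ht⟩ := g.exists_isPartIndex
  have hta := ht.Y e he a ha
  obtain ⟨u, v, rfl⟩ : ∃ u v, e = s(u, v) := by
    induction e with | _ u v => exact ⟨u, v, rfl⟩
  refine (g.deg_le_card (s := {g.orig u, g.orig v, g.x s(u, v) u, g.x s(u, v) v})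
    fun b hb => ?_).trans card_le_four
  have hu : ∀ e' ∈ G.edgeFinset, a ∈ g.Y e' → e' = s(u, v) := fun e' he' ha' =>
    by_contra fun hne => disjoint_left.1 (g.Y_disjoint e' he' _ he hne) ha' ha
  have hmem : ∀ w, w ∈ s(u, v) → w = u ∨ w = v := fun w => Sym2.mem_iff.1
  rw [ht.adj_iff_adjSpec (by omega)] at hb
  cases ht
  rcases hb with ⟨rfl, h⟩ | ⟨s', hs', rfl, h⟩ | ⟨v', rfl, h⟩ | ⟨e', he', v', hv', rfl, h | h⟩ |
    ⟨e', he', v', hv', rfl, h | h | h⟩ | ⟨e', he', rfl, h⟩ |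
    ⟨e', he', i, rfl, h | ⟨v', hv', h⟩ | ⟨v', hv', h⟩⟩ <;> grind

theorem deg_le_four_of_mem_Z (g : Gadget V G wt) {e : Sym2 V} (he : e ∈ G.edgeFinset)
    {a : g.VH} (ha : a ∈ g.Z e) : g.deg a ≤ 4 := by
  obtain ⟨t, ht⟩ := g.exists_isPartIndex
  have hta := ht.Z e he a ha
  obtain ⟨u, v, rfl⟩ : ∃ u v, e = s(u, v) := by
    induction e with | _ u v => exact ⟨u, v, rfl⟩
  refine (g.deg_le_card (s := {g.x s(u, v) u, g.x s(u, v) v, g.q s(u, v) 0, g.q s(u, v) 1})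
    fun b hb => ?_).trans card_le_four
  have hu : ∀ e' ∈ G.edgeFinset, a ∈ g.Z e' → e' = s(u, v) := fun e' he' ha' =>
    by_contra fun hne => disjoint_left.1 (g.Z_disjoint e' he' _ he hne) ha' ha
  have hmem : ∀ w, w ∈ s(u, v) → w = u ∨ w = v := fun w => Sym2.mem_iff.1
  have hq2 : ∀ h : Fin 2, g.q s(u, v) h = g.q s(u, v) 0 ∨ g.q s(u, v) h = g.q s(u, v) 1 :=
    Fin.forall_fin_two.2 ⟨.inl rfl, .inr rfl⟩
  simp only [mem_insert, mem_singleton]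
  rw [ht.adj_iff_adjSpec (by omega)] at hb
  cases ht
  rcases hb with ⟨rfl, h⟩ | ⟨s', hs', rfl, h⟩ | ⟨v', rfl, h⟩ | ⟨e', he', v', hv', rfl, h | h⟩ |
    ⟨e', he', v', hv', rfl, h | h | h⟩ | ⟨e', he', rfl, h⟩ |
    ⟨e', he', i, rfl, h | ⟨v', hv', h⟩ | ⟨v', hv', h⟩⟩ <;> grind

theorem deg_le_five_of_mem_L (g : Gadget V G wt) {e : Sym2 V} (he : e ∈ G.edgeFinset)
    {v : V} (hv : v ∈ e) {a : g.VH} (ha : a ∈ g.L e v) : g.deg a ≤ 5 := by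
  obtain ⟨t, ht⟩ := g.exists_isPartIndex
  have hta := ht.L e he v hv a ha
  refine (g.deg_le_card (s := {g.sstar, g.orig v, g.x e v, g.q e 0, g.q e 1})
    fun b hb => ?_).trans card_le_five
  have hu : ∀ e' ∈ G.edgeFinset, ∀ v' ∈ e', a ∈ g.L e' v' → e' = e ∧ v' = v :=
    fun e' he' v' hv' ha' => by
      by_contra hne
      exact disjoint_left.1 (g.L_disjoint e' he' v' hv' e he v hv (by simpa using hne)) ha' ha
  have hq2 : ∀ h : Fin 2, g.q e h = g.q e 0 ∨ g.q e h = g.q e 1 :=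
    Fin.forall_fin_two.2 ⟨.inl rfl, .inr rfl⟩
  simp only [mem_insert, mem_singleton]
  rw [ht.adj_iff_adjSpec (by omega)] at hb
  cases ht
  rcases hb with ⟨rfl, h⟩ | ⟨s', hs', rfl, h⟩ | ⟨v', rfl, h⟩ | ⟨e', he', v', hv', rfl, h | h⟩ |
    ⟨e', he', v', hv', rfl, h | h | h⟩ | ⟨e', he', rfl, h⟩ |
    ⟨e', he', i, rfl, h | ⟨v', hv', h⟩ | ⟨v', hv', h⟩⟩ <;> grind

theorem deg_le_one_of_mem_Sleaves (g : Gadget V G wt) {a : g.VH} (ha : a ∈ g.Sleaves)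
    (hL : ∀ e ∈ G.edgeFinset, ∀ v ∈ e, a ∉ g.L e v) : g.deg a ≤ 1 := by
  obtain ⟨t, ht⟩ := g.exists_isPartIndex
  have hta := ht.Sleaves a ha
  refine (g.deg_le_card (s := {g.sstar}) fun b hb => ?_).trans (card_singleton _).le
  rw [ht.adj_iff_adjSpec (by omega)] at hb
  cases ht
  rcases hb with ⟨rfl, h⟩ | ⟨s', hs', rfl, h⟩ | ⟨v', rfl, h⟩ | ⟨e', he', v', hv', rfl, h | h⟩ |
    ⟨e', he', v', hv', rfl, h | h | h⟩ | ⟨e', he', rfl, h⟩ |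
    ⟨e', he', i, rfl, h | ⟨v', hv', h⟩ | ⟨v', hv', h⟩⟩ <;> grind

theorem deg_lt_of_notMem_bigSet [Nonempty V] (hwt : ∀ e ∈ G.edgeFinset, 1 ≤ wt e)
    (g : Gadget V G wt) {a : g.VH} (ha : a ∉ g.bigSet) : g.deg a < numColors G wt - 1 := by
  have hn : 1 ≤ Fintype.card V := Fintype.card_pos
  have hk : 3 ≤ numColors G wt := by
    rw [numColors]
    omega
  have hk' : ∀ e ∈ G.edgeFinset, 8 ≤ numColors G wt := fun e he => by
    have hm : 1 ≤ G.edgeFinset.card := card_pos.2 ⟨e, he⟩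
    have hW : 1 ≤ totW G wt :=
      (hwt e he).trans (single_le_sum (f := wt) (fun _ _ => Nat.zero_le _) he)
    rw [numColors]
    omega
  obtain ⟨p, hp, hap⟩ := g.parts_cover a
  simp only [GadgetData.bigSet, mem_union, not_or] at ha
  obtain ⟨⟨⟨⟨h0, h4⟩, h9⟩, h2⟩, h6⟩ := ha
  simp only [GadgetData.parts, List.mem_cons, List.not_mem_nil, or_false] at hp
  rcases hp with rfl | rfl | rfl | rfl | rfl | rfl | rfl | rfl | rfl | rfl
  · exact absurd hap h0
  · by_cases hL : ∀ e ∈ G.edgeFinset, ∀ v ∈ e, a ∉ g.L e v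
    · have := g.deg_le_one_of_mem_Sleaves hap hL
      omega
    · push Not at hL
      obtain ⟨e, he, v, hv, hae⟩ := hL
      have := g.deg_le_five_of_mem_L he hv hae
      have := hk' e he
      omega
  · exact absurd hap h2
  · obtain ⟨s, hs, hap⟩ := mem_biUnion.1 hap
    have := g.deg_le_one_of_mem_Aleaves hs hap
    omega
  · exact absurd hap h4
  · obtain ⟨v, -, hap⟩ := mem_biUnion.1 hap
    have := g.deg_le_one_of_mem_P hap
    omega
  · exact absurd hap h6
  · obtain ⟨e, he, hap⟩ := mem_biUnion.1 hap
    have := g.deg_le_four_of_mem_Y he hap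
    have := hk' e he
    omega
  · obtain ⟨e, he, hap⟩ := mem_biUnion.1 hap
    have := g.deg_le_four_of_mem_Z he hap
    have := hk' e he
    omega
  · exact absurd hap h9

theorem card_Xset (g : Gadget V G wt) : g.Xset.card = 2 * G.edgeFinset.card := by
  rw [GadgetData.Xset, card_biUnion, mul_comm, ← smul_eq_mul, ← sum_const]
  · refine sum_congr rfl fun e he => ?_
    rw [card_image_of_injOn]
    · induction e with | _ u v =>
      have hne : u ≠ v := G.ne_of_adj (by simpa using he)
      rw [← card_pair hne]
      congr 1
      ext w
      simp
    · intro v hv v' hv' h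
      exact congrArg Prod.snd (g.x_inj e he v (by simpa using hv) e he v' (by simpa using hv') h)
  · intro e he e' he' hne
    refine disjoint_left.2 fun b hb hb' => ?_
    obtain ⟨v, hv, rfl⟩ := mem_image.1 hb
    obtain ⟨v', hv', h⟩ := mem_image.1 hb'
    exact hne (congrArg Prod.fst
      (g.x_inj e he v (by simpa using hv) e' he' v' (by simpa using hv') h.symm))

theorem card_Qset (g : Gadget V G wt) : g.Qset.card = 2 * G.edgeFinset.card := by
  rw [GadgetData.Qset, card_biUnion, mul_comm, ← smul_eq_mul, ← sum_const]
  · exact sum_congr rfl fun e he => card_pair fun h => by simpa using g.q_inj _ he _ _ he _ h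
  · intro e he e' he' hne
    have hq : ∀ h h', g.q e h ≠ g.q e' h' := fun h h' heq =>
      hne (congrArg Prod.fst (g.q_inj e he h e' he' h' heq))
    simp [(hq _ _).symm]

theorem card_bigSet (g : Gadget V G wt) :
    g.bigSet.card = 2 * totW G wt + 4 * G.edgeFinset.card + Fintype.card V + 2 := by
  let := g.fintypeVH
  have hd := g.parts_disjoint
  simp only [GadgetData.parts, List.pairwise_cons, List.mem_cons, List.not_mem_nil, or_false,
    forall_eq_or_imp, forall_eq] at hd
  rw [GadgetData.bigSet, card_union_of_disjoint, card_union_of_disjoint,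
    card_union_of_disjoint, card_union_of_disjoint, g.card_Xset, g.card_Qset, g.card_Acenters,
    card_image_of_injective _ g.orig_inj, card_univ, card_singleton]
  · omega
  all_goals grind [disjoint_union_left]

end Gadget

/-- In `H`, the set of vertices of degree at least `k - 1` is exactly
`{s*} ∪ V(G) ∪ Q ∪ A ∪ X`, and this set has size `2W + 4m + n + 2 = k + m`. -/
theorem highDegree_vertices_eq_bigSet
    {V : Type*} [Fintype V] [DecidableEq V] (G : SimpleGraph V) [DecidableRel G.Adj]
    (wt : Sym2 V → ℕ) (hconn : G.Connected)
    (hwt : ∀ e ∈ G.edgeFinset, 1 ≤ wt e)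
    (heven : ∀ v : V, Even (vertW G wt v))
    (g : Gadget V G wt) :
    (letI := g.fintypeVH; letI := g.decEqVH;
      Finset.univ.filter (fun a : g.VH => numColors G wt - 1 ≤ g.deg a)) = g.bigSet ∧
    g.bigSet.card = 2 * totW G wt + 4 * G.edgeFinset.card + Fintype.card V + 2 ∧
    2 * totW G wt + 4 * G.edgeFinset.card + Fintype.card V + 2 =
      numColors G wt + G.edgeFinset.card := by
  refine ⟨?_, g.card_bigSet, ?_⟩
  · let := g.fintypeVH
    have := hconn.nonempty
    ext a
    simp only [mem_filter, mem_univ, true_and]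
    exact ⟨fun h => by_contra fun ha => (g.deg_lt_of_notMem_bigSet hwt ha).not_ge h,
      g.le_deg_of_mem_bigSet⟩
  · rw [numColors]
    omega
end

section
/- The pair (G, w) admits a circulating orientation if and only if the constructed graph H admits a b-coloring with k = 2W + 3m + n + 2 colors. -/
open Finset

variable {V : Type*} [Fintype V] [DecidableEq V]

namespace GadgetData

attribute [local instance] fintypeVH decEqVH

variable {G : SimpleGraph V} [DecidableRel G.Adj] {wt : Sym2 V → ℕ}

/-- The index of the first part containing `a`. -/
def kind (g : GadgetData V G wt) (a : g.VH) : ℕ :=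
  g.parts.findIdx (fun p => a ∈ p)

/-- The four vertices `x_{e,u}, x_{e,v}, q_{e,1}, q_{e,2}` of an edge `e = uv`. -/
def quad (g : GadgetData V G wt) (e : Sym2 V) : Finset g.VH :=
  (univ.filter (· ∈ e)).image (g.x e) ∪ {g.q e 0, g.q e 1}

end GadgetData

namespace Gadget

attribute [local instance] GadgetData.fintypeVH GadgetData.decEqVH

variable {G : SimpleGraph V} [DecidableRel G.Adj] {wt : Sym2 V → ℕ} (g : Gadget V G wt)

theorem kind_eq {a : g.VH} {i : ℕ} (hi : i < g.parts.length) (ha : a ∈ g.parts[i]) :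
    g.kind a = i := by
  rw [GadgetData.kind, List.findIdx_eq hi]
  refine ⟨by simpa using ha, fun j hj => ?_⟩
  have hd := List.pairwise_iff_getElem.1 g.parts_disjoint j i (hj.trans hi) hi hj
  simpa using fun h => Finset.disjoint_left.1 hd h ha

theorem kind_sstar : g.kind g.sstar = 0 :=
  g.kind_eq (i := 0) (by simp [GadgetData.parts]) (by simp [GadgetData.parts])

theorem kind_Sleaves {a : g.VH} (ha : a ∈ g.Sleaves) : g.kind a = 1 :=
  g.kind_eq (i := 1) (by simp [GadgetData.parts]) (by simpa [GadgetData.parts])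

theorem kind_L {a : g.VH} {e : Sym2 V} {v : V} (he : e ∈ G.edgeFinset) (hv : v ∈ e)
    (ha : a ∈ g.L e v) : g.kind a = 1 :=
  g.kind_Sleaves (g.L_subset e he v hv ha)

theorem kind_Acenters {a : g.VH} (ha : a ∈ g.Acenters) : g.kind a = 2 :=
  g.kind_eq (i := 2) (by simp [GadgetData.parts]) (by simpa [GadgetData.parts])

theorem kind_Aleaves {a s : g.VH} (hs : s ∈ g.Acenters) (ha : a ∈ g.Aleaves s) :
    g.kind a = 3 :=
  g.kind_eq (i := 3) (by simp [GadgetData.parts]) (by simpa [GadgetData.parts] using ⟨s, hs, ha⟩)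

theorem kind_orig (v : V) : g.kind (g.orig v) = 4 :=
  g.kind_eq (i := 4) (by simp [GadgetData.parts]) (by simp [GadgetData.parts])

theorem kind_P {a : g.VH} {v : V} (ha : a ∈ g.P v) : g.kind a = 5 :=
  g.kind_eq (i := 5) (by simp [GadgetData.parts]) (by simpa [GadgetData.parts] using ⟨v, ha⟩)

theorem kind_x {e : Sym2 V} {v : V} (he : e ∈ G.edgeFinset) (hv : v ∈ e) :
    g.kind (g.x e v) = 6 :=
  g.kind_eq (i := 6) (by simp [GadgetData.parts]) (by
    simpa [GadgetData.parts, GadgetData.Xset] using ⟨e, by simpa using he, v, hv, rfl⟩)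

theorem kind_Y {a : g.VH} {e : Sym2 V} (he : e ∈ G.edgeFinset) (ha : a ∈ g.Y e) :
    g.kind a = 7 :=
  g.kind_eq (i := 7) (by simp [GadgetData.parts]) (by
    simpa [GadgetData.parts] using ⟨e, by simpa using he, ha⟩)

theorem kind_Z {a : g.VH} {e : Sym2 V} (he : e ∈ G.edgeFinset) (ha : a ∈ g.Z e) :
    g.kind a = 8 :=
  g.kind_eq (i := 8) (by simp [GadgetData.parts]) (by
    simpa [GadgetData.parts] using ⟨e, by simpa using he, ha⟩)

theorem kind_q {e : Sym2 V} (he : e ∈ G.edgeFinset) (h : Fin 2) : g.kind (g.q e h) = 9 :=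
  g.kind_eq (i := 9) (by simp [GadgetData.parts]) (by
    simp only [GadgetData.parts, GadgetData.Qset, List.getElem_cons_succ, List.getElem_cons_zero,
      mem_biUnion, mem_insert, mem_singleton]
    refine ⟨e, he, ?_⟩
    fin_cases h <;> simp)

theorem cases_vertex (a : g.VH) :
    a = g.sstar ∨ a ∈ g.Sleaves ∨ a ∈ g.Acenters ∨ (∃ s ∈ g.Acenters, a ∈ g.Aleaves s) ∨
      (∃ v, a = g.orig v) ∨ (∃ v, a ∈ g.P v) ∨ (∃ e ∈ G.edgeFinset, ∃ v ∈ e, a = g.x e v) ∨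
      (∃ e ∈ G.edgeFinset, a ∈ g.Y e) ∨ (∃ e ∈ G.edgeFinset, a ∈ g.Z e) ∨
      ∃ e ∈ G.edgeFinset, ∃ h, a = g.q e h := by
  obtain ⟨p, hp, ha⟩ := g.parts_cover a
  simp only [GadgetData.parts, GadgetData.Xset, GadgetData.Qset, List.mem_cons,
    List.not_mem_nil, or_false] at hp
  rcases hp with rfl | rfl | rfl | rfl | rfl | rfl | rfl | rfl | rfl | rfl
  · simp_all
  · simp_all
  · simp_all
  · exact .inr <| .inr <| .inr <| .inl <| by simpa only [mem_biUnion] using ha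
  · simp only [mem_image, mem_univ, true_and] at ha; obtain ⟨v, rfl⟩ := ha
    exact .inr <| .inr <| .inr <| .inr <| .inl ⟨v, rfl⟩
  · simp only [mem_biUnion, mem_univ, true_and] at ha; tauto
  · simp only [mem_biUnion, mem_image, mem_filter, mem_univ, true_and] at ha
    obtain ⟨e, he, v, hv, rfl⟩ := ha
    exact .inr <| .inr <| .inr <| .inr <| .inr <| .inr <| .inl ⟨e, he, v, hv, rfl⟩
  · exact .inr <| .inr <| .inr <| .inr <| .inr <| .inr <| .inr <| .inl <| by
      simpa only [mem_biUnion] using ha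
  · exact .inr <| .inr <| .inr <| .inr <| .inr <| .inr <| .inr <| .inr <| .inl <| by
      simpa only [mem_biUnion] using ha
  · simp only [mem_biUnion, mem_insert, mem_singleton] at ha
    obtain ⟨e, he, rfl | rfl⟩ := ha
    · exact .inr <| .inr <| .inr <| .inr <| .inr <| .inr <| .inr <| .inr <| .inr ⟨e, he, 0, rfl⟩
    · exact .inr <| .inr <| .inr <| .inr <| .inr <| .inr <| .inr <| .inr <| .inr ⟨e, he, 1, rfl⟩

theorem eq_of_mem_L {e e' : Sym2 V} {v v' : V} {a : g.VH} (he : e ∈ G.edgeFinset) (hv : v ∈ e)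
    (he' : e' ∈ G.edgeFinset) (hv' : v' ∈ e') (ha : a ∈ g.L e v) (ha' : a ∈ g.L e' v') :
    e = e' ∧ v = v' := by
  by_contra h
  exact disjoint_left.1 (g.L_disjoint e he v hv e' he' v' hv' (by simpa using h)) ha ha'

theorem eq_of_mem_P {v v' : V} {a : g.VH} (ha : a ∈ g.P v) (ha' : a ∈ g.P v') : v = v' := by
  by_contra h
  exact disjoint_left.1 (g.P_disjoint v v' h) ha ha'

theorem eq_of_mem_Y {e e' : Sym2 V} {a : g.VH} (he : e ∈ G.edgeFinset)
    (he' : e' ∈ G.edgeFinset) (ha : a ∈ g.Y e) (ha' : a ∈ g.Y e') : e = e' := by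
  by_contra h
  exact disjoint_left.1 (g.Y_disjoint e he e' he' h) ha ha'

theorem eq_of_mem_Z {e e' : Sym2 V} {a : g.VH} (he : e ∈ G.edgeFinset)
    (he' : e' ∈ G.edgeFinset) (ha : a ∈ g.Z e) (ha' : a ∈ g.Z e') : e = e' := by
  by_contra h
  exact disjoint_left.1 (g.Z_disjoint e he e' he' h) ha ha'

theorem eq_of_mem_Aleaves {s s' a : g.VH} (hs : s ∈ g.Acenters) (hs' : s' ∈ g.Acenters)
    (ha : a ∈ g.Aleaves s) (ha' : a ∈ g.Aleaves s') : s = s' := by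
  by_contra h
  exact disjoint_left.1 (g.Aleaves_disjoint s hs s' hs' h) ha ha'

theorem eq_of_x_eq {e e' : Sym2 V} {v v' : V} (he : e ∈ G.edgeFinset) (hv : v ∈ e)
    (he' : e' ∈ G.edgeFinset) (hv' : v' ∈ e') (h : g.x e v = g.x e' v') : e = e' ∧ v = v' := by
  simpa using g.x_inj e he v hv e' he' v' hv' h

theorem eq_of_q_eq {e e' : Sym2 V} {h h' : Fin 2} (he : e ∈ G.edgeFinset)
    (he' : e' ∈ G.edgeFinset) (hq : g.q e h = g.q e' h') : e = e' ∧ h = h' := by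
  simpa using g.q_inj e he h e' he' h' hq

theorem eq_of_mem_quad {e e' : Sym2 V} {a : g.VH} (he : e ∈ G.edgeFinset)
    (he' : e' ∈ G.edgeFinset) (ha : a ∈ g.quad e) (ha' : a ∈ g.quad e') : e = e' := by
  simp only [GadgetData.quad, mem_union, mem_image, mem_filter, mem_univ, true_and, mem_insert,
    mem_singleton] at ha ha'
  grind [kind_x, kind_q, eq_of_x_eq, eq_of_q_eq]

theorem orig_notMem_quad {e : Sym2 V} (he : e ∈ G.edgeFinset) (v : V) :
    g.orig v ∉ g.quad e := by
  simp only [GadgetData.quad, mem_union, mem_image, mem_filter, mem_univ, true_and, mem_insert,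
    mem_singleton]
  grind [kind_x, kind_q, kind_orig]

theorem adj_orig {v : V} {b : g.VH} (h : g.H.Adj (g.orig v) b) :
    b ∈ g.P v ∨ ∃ e ∈ G.edgeFinset, v ∈ e ∧ (b ∈ g.L e v ∨ b ∈ g.Y e) := by
  have hi := g.orig_inj
  rw [g.adj_iff] at h
  simp only [GadgetData.AdjSpec] at h
  rcases h with (h | h | h | h | h | h | h) | (h | h | h | h | h | h | h) <;>
  grind [kind_sstar, kind_Sleaves, kind_L, kind_Acenters, kind_Aleaves, kind_orig, kind_P, kind_x,
    kind_Y, kind_Z, kind_q, Function.Injective]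

theorem adj_x {e : Sym2 V} (he : e ∈ G.edgeFinset) {v : V} (hv : v ∈ e) {b : g.VH}
    (h : g.H.Adj (g.x e v) b) :
    b ∈ g.Y e ∨ b ∈ g.Z e ∨ b ∈ g.L e v ∨ ∃ h, b = g.q e h := by
  rw [g.adj_iff] at h
  simp only [GadgetData.AdjSpec] at h
  rcases h with (h | h | h | h | h | h | h) | (h | h | h | h | h | h | h) <;>
  grind [kind_sstar, kind_Sleaves, kind_L, kind_Acenters, kind_Aleaves, kind_orig, kind_P, kind_x,
    kind_Y, kind_Z, kind_q, eq_of_x_eq]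

theorem adj_q {e : Sym2 V} (he : e ∈ G.edgeFinset) {h : Fin 2} {b : g.VH}
    (hb : g.H.Adj (g.q e h) b) :
    (∃ h' ≠ h, b = g.q e h') ∨ b ∈ g.Z e ∨ (∃ v ∈ e, b ∈ g.L e v) ∨ ∃ v ∈ e, b = g.x e v := by
  rw [g.adj_iff] at hb
  simp only [GadgetData.AdjSpec] at hb
  rcases hb with (h | h | h | h | h | h | h) | (h | h | h | h | h | h | h) <;>
  grind [kind_sstar, kind_Sleaves, kind_L, kind_Acenters, kind_Aleaves, kind_orig, kind_P, kind_x,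
    kind_Y, kind_Z, kind_q, eq_of_q_eq]

theorem adj_L {e : Sym2 V} (he : e ∈ G.edgeFinset) {v : V} (hv : v ∈ e) {a b : g.VH}
    (ha : a ∈ g.L e v) (h : g.H.Adj a b) :
    b ∈ ({g.sstar, g.orig v, g.x e v, g.q e 0, g.q e 1} : Finset g.VH) := by
  have hk := g.kind_L he hv ha
  have h01 : ∀ i, g.q e i = g.q e 0 ∨ g.q e i = g.q e 1 := by
    intro i; fin_cases i <;> simp
  rw [g.adj_iff] at h
  simp only [GadgetData.AdjSpec] at h
  simp only [mem_insert, mem_singleton]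
  rcases h with (h | h | h | h | h | h | h) | (h | h | h | h | h | h | h) <;>
  grind [kind_sstar, kind_Sleaves, kind_L, kind_Acenters, kind_Aleaves, kind_orig, kind_P, kind_x,
    kind_Y, kind_Z, kind_q, eq_of_mem_L]

theorem adj_Sleaves {a b : g.VH} (ha : a ∈ g.Sleaves)
    (hL : ∀ e ∈ G.edgeFinset, ∀ v ∈ e, a ∉ g.L e v) (h : g.H.Adj a b) :
    b ∈ ({g.sstar} : Finset g.VH) := by
  have hk := g.kind_Sleaves ha
  rw [g.adj_iff] at h
  simp only [GadgetData.AdjSpec] at h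
  simp only [mem_singleton]
  rcases h with (h | h | h | h | h | h | h) | (h | h | h | h | h | h | h) <;>
  grind [kind_sstar, kind_Sleaves, kind_L, kind_Acenters, kind_Aleaves, kind_orig, kind_P, kind_x,
    kind_Y, kind_Z, kind_q]

theorem adj_Aleaves {a b s : g.VH} (hs : s ∈ g.Acenters) (ha : a ∈ g.Aleaves s)
    (h : g.H.Adj a b) : b ∈ ({s} : Finset g.VH) := by
  have hk := g.kind_Aleaves hs ha
  rw [g.adj_iff] at h
  simp only [GadgetData.AdjSpec] at h
  simp only [mem_singleton]
  rcases h with (h | h | h | h | h | h | h) | (h | h | h | h | h | h | h) <;>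
  grind [kind_sstar, kind_Sleaves, kind_L, kind_Acenters, kind_Aleaves, kind_orig, kind_P, kind_x,
    kind_Y, kind_Z, kind_q, eq_of_mem_Aleaves]

theorem adj_P {a b : g.VH} {v : V} (ha : a ∈ g.P v) (h : g.H.Adj a b) :
    b ∈ ({g.orig v} : Finset g.VH) := by
  have hk := g.kind_P ha
  rw [g.adj_iff] at h
  simp only [GadgetData.AdjSpec] at h
  simp only [mem_singleton]
  rcases h with (h | h | h | h | h | h | h) | (h | h | h | h | h | h | h) <;>
  grind [kind_sstar, kind_Sleaves, kind_L, kind_Acenters, kind_Aleaves, kind_orig, kind_P, kind_x,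
    kind_Y, kind_Z, kind_q, eq_of_mem_P]

theorem adj_Y {a b : g.VH} {u v : V} (he : s(u, v) ∈ G.edgeFinset) (ha : a ∈ g.Y s(u, v))
    (h : g.H.Adj a b) :
    b ∈ ({g.orig u, g.orig v, g.x s(u, v) u, g.x s(u, v) v} : Finset g.VH) := by
  have hk := g.kind_Y he ha
  rw [g.adj_iff] at h
  simp only [GadgetData.AdjSpec] at h
  simp only [mem_insert, mem_singleton]
  rcases h with (h | h | h | h | h | h | h) | (h | h | h | h | h | h | h) <;>
  grind [kind_sstar, kind_Sleaves, kind_L, kind_Acenters, kind_Aleaves, kind_orig, kind_P, kind_x,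
    kind_Y, kind_Z, kind_q, eq_of_mem_Y]

theorem adj_Z {a b : g.VH} {u v : V} (he : s(u, v) ∈ G.edgeFinset) (ha : a ∈ g.Z s(u, v))
    (h : g.H.Adj a b) :
    b ∈ ({g.x s(u, v) u, g.x s(u, v) v, g.q s(u, v) 0, g.q s(u, v) 1} : Finset g.VH) := by
  have hk := g.kind_Z he ha
  have h01 : ∀ i, g.q s(u, v) i = g.q s(u, v) 0 ∨ g.q s(u, v) i = g.q s(u, v) 1 := by
    intro i; fin_cases i <;> simp
  rw [g.adj_iff] at h
  simp only [GadgetData.AdjSpec] at h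
  simp only [mem_insert, mem_singleton]
  rcases h with (h | h | h | h | h | h | h) | (h | h | h | h | h | h | h) <;>
  grind [kind_sstar, kind_Sleaves, kind_L, kind_Acenters, kind_Aleaves, kind_orig, kind_P, kind_x,
    kind_Y, kind_Z, kind_q, eq_of_mem_Z]

end Gadget

section BVertex

variable {VH : Type*} {H : SimpleGraph VH} {k : ℕ} {c : VH → Fin k} {a : VH}

theorem IsBVertex.erase_subset_image (h : IsBVertex H c a) {N : Finset VH}
    (hN : ∀ b, H.Adj a b → b ∈ N) : univ.erase (c a) ⊆ N.image c := by
  intro col hcol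
  obtain ⟨b, hb, rfl⟩ := h col (ne_of_mem_erase hcol)
  exact mem_image_of_mem c (hN b hb)

theorem IsBVertex.le_card_image (h : IsBVertex H c a) {N : Finset VH}
    (hN : ∀ b, H.Adj a b → b ∈ N) : k ≤ (N.image c).card + 1 := by
  have := card_le_card (h.erase_subset_image hN)
  rw [card_erase_of_mem (mem_univ _), card_univ, Fintype.card_fin] at this
  omega

theorem IsBVertex.le_card (h : IsBVertex H c a) {N : Finset VH}
    (hN : ∀ b, H.Adj a b → b ∈ N) : k ≤ N.card + 1 :=
  (h.le_card_image hN).trans (by gcongr; exact card_image_le)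

theorem IsBVertex.injOn (h : IsBVertex H c a) {N : Finset VH}
    (hN : ∀ b, H.Adj a b → b ∈ N) (hcard : N.card + 1 ≤ k) : Set.InjOn c N := by
  rw [← card_image_iff]
  have := h.le_card_image hN
  exact le_antisymm card_image_le (by omega)

end BVertex

section Weights

variable (G : SimpleGraph V) [DecidableRel G.Adj] (wt : Sym2 V → ℕ)

/-- The total weight entering `v` under `o`. -/
def inW (o : Sym2 V → V) (v : V) : ℕ :=
  ∑ e ∈ G.edgeFinset.filter (fun e => v ∈ e ∧ o e = v), wt e

/-- The total weight leaving `v` under `o`. -/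
def outW (o : Sym2 V → V) (v : V) : ℕ :=
  ∑ e ∈ G.edgeFinset.filter (fun e => v ∈ e ∧ o e ≠ v), wt e

theorem inW_add_outW (o : Sym2 V → V) (v : V) :
    inW G wt o v + outW G wt o v = vertW G wt v := by
  rw [inW, outW, vertW, ← sum_filter_add_sum_filter_not (G.edgeFinset.filter (v ∈ ·)) (o · = v),
    filter_filter, filter_filter]

variable {G}

theorem exists_eq_mk_of_mem_edgeFinset {V : Type*} {G : SimpleGraph V} [Fintype G.edgeSet]
    {e : Sym2 V} (he : e ∈ G.edgeFinset) :
    ∃ u v, u ≠ v ∧ e = s(u, v) := by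
  induction e with
  | _ u v => exact ⟨u, v, (G.mem_edgeSet.1 (G.mem_edgeFinset.1 he)).ne, rfl⟩

theorem card_filter_mem_edge {e : Sym2 V} (he : e ∈ G.edgeFinset) :
    (univ.filter (· ∈ e)).card = 2 := by
  obtain ⟨u, v, huv, rfl⟩ := exists_eq_mk_of_mem_edgeFinset he
  rw [← card_pair huv]
  congr 1
  ext w
  simp

variable (G)

theorem sum_vertW : ∑ v, vertW G wt v = 2 * totW G wt := by
  simp only [vertW, sum_filter]
  rw [sum_comm, totW, mul_sum]
  refine sum_congr rfl fun e he => ?_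
  rw [← sum_filter, sum_const, card_filter_mem_edge he, smul_eq_mul]

theorem sum_inW {o : Sym2 V → V} (ho : ∀ e ∈ G.edgeFinset, o e ∈ e) :
    ∑ v, inW G wt o v = totW G wt := by
  simp only [inW, sum_filter]
  rw [sum_comm, totW]
  refine sum_congr rfl fun e he => ?_
  rw [sum_eq_single (o e)] <;> simp +contextual [ho e he, eq_comm]

theorem isCirculating_of_vertW_le {o : Sym2 V → V} (ho : ∀ e ∈ G.edgeFinset, o e ∈ e)
    (h : ∀ v, vertW G wt v ≤ 2 * outW G wt o v) : IsCirculating G wt o := by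
  refine ⟨ho, ?_⟩
  have hle : ∀ v ∈ univ, inW G wt o v ≤ outW G wt o v := fun v _ => by
    have := h v
    have := inW_add_outW G wt o v
    omega
  have hsum : ∑ v, inW G wt o v = ∑ v, outW G wt o v := by
    have h1 := sum_inW G wt ho
    have h2 := sum_vertW G wt
    simp only [← inW_add_outW G wt o, sum_add_distrib] at h2
    omega
  intro v
  exact (sum_eq_sum_iff_of_le hle).1 hsum v (mem_univ v)

end Weights

namespace Gadget

attribute [local instance] GadgetData.fintypeVH GadgetData.decEqVH

variable {G : SimpleGraph V} [DecidableRel G.Adj] {wt : Sym2 V → ℕ} (g : Gadget V G wt)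

theorem mem_quad {e : Sym2 V} {a : g.VH} :
    a ∈ g.quad e ↔ (∃ v ∈ e, g.x e v = a) ∨ ∃ h, a = g.q e h := by
  simp [GadgetData.quad, Fin.exists_fin_two, or_comm, or_assoc]

theorem card_quad_le {e : Sym2 V} (he : e ∈ G.edgeFinset) : (g.quad e).card ≤ 4 := by
  refine (card_union_le _ _).trans ?_
  have h1 := card_filter_mem_edge he
  have h2 : ((univ.filter (· ∈ e)).image (g.x e)).card ≤ _ := card_image_le
  have h3 : ({g.q e 0, g.q e 1} : Finset g.VH).card ≤ 2 := card_le_two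
  omega

/-- The vertices of degree at least `k - 1`. -/
def candidates : Finset g.VH :=
  {g.sstar} ∪ g.Acenters ∪ univ.image g.orig ∪ G.edgeFinset.biUnion g.quad

theorem card_candidates_le : g.candidates.card ≤ numColors G wt + G.edgeFinset.card := by
  have h1 : (univ.image g.orig).card ≤ _ := card_image_le
  have h2 : (G.edgeFinset.biUnion g.quad).card ≤ _ :=
    card_biUnion_le_card_mul _ _ _ fun e he => g.card_quad_le he
  have h3 := card_union_le ({g.sstar} ∪ g.Acenters ∪ univ.image g.orig) (G.edgeFinset.biUnion g.quad)
  have h4 := card_union_le ({g.sstar} ∪ g.Acenters) (univ.image g.orig)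
  have h5 := card_union_le {g.sstar} g.Acenters
  have h6 := g.card_Acenters
  rw [card_univ] at h1
  rw [card_singleton] at h5
  rw [candidates, numColors]
  omega

theorem nine_le_numColors (hwt : ∀ e ∈ G.edgeFinset, 1 ≤ wt e) {e : Sym2 V}
    (he : e ∈ G.edgeFinset) : 9 ≤ numColors G wt := by
  have h1 : 1 ≤ totW G wt := (hwt e he).trans (single_le_sum (f := wt) (fun _ _ => Nat.zero_le _) he)
  have h2 : 1 ≤ G.edgeFinset.card := card_pos.2 ⟨e, he⟩
  have h3 : 2 ≤ Fintype.card V := (card_filter_mem_edge he).symm.le.trans (card_le_univ _)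
  rw [numColors]
  omega

theorem isBVertex_mem_candidates [Nonempty V] (hwt : ∀ e ∈ G.edgeFinset, 1 ≤ wt e)
    {c : g.VH → Fin (numColors G wt)} {a : g.VH} (ha : IsBVertex g.H c a) :
    a ∈ g.candidates := by
  have hk : 3 ≤ numColors G wt := by
    have := Fintype.card_pos (α := V)
    rw [numColors]; omega
  have h4 (p q r s : g.VH) : ({p, q, r, s} : Finset g.VH).card ≤ 4 := card_le_four
  have h5 (p q r s t : g.VH) : ({p, q, r, s, t} : Finset g.VH).card ≤ 5 := card_le_five
  simp only [candidates, mem_union, mem_singleton, mem_image, mem_univ, true_and, mem_biUnion,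
    mem_quad]
  rcases g.cases_vertex a with h | h | h | ⟨s, hs, h⟩ | ⟨v, h⟩ | ⟨v, h⟩ | ⟨e, he, v, hv, h⟩ |
    ⟨e, he, h⟩ | ⟨e, he, h⟩ | ⟨e, he, i, h⟩
  · simp [h]
  · by_cases hL : ∃ e ∈ G.edgeFinset, ∃ v ∈ e, a ∈ g.L e v
    · obtain ⟨e, he, v, hv, hL⟩ := hL
      have := ha.le_card fun b => g.adj_L he hv hL
      have := nine_le_numColors hwt he
      have := h5 g.sstar (g.orig v) (g.x e v) (g.q e 0) (g.q e 1)
      omega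
    · push Not at hL
      have := ha.le_card fun b => g.adj_Sleaves h hL
      rw [card_singleton] at this
      omega
  · simp [h]
  · have := ha.le_card fun b => g.adj_Aleaves hs h
    rw [card_singleton] at this
    omega
  · exact .inl <| .inr ⟨v, h.symm⟩
  · have := ha.le_card fun b => g.adj_P h
    rw [card_singleton] at this
    omega
  · exact .inr ⟨e, he, .inl ⟨v, hv, h.symm⟩⟩
  · have := nine_le_numColors hwt he
    obtain ⟨u, v, -, rfl⟩ := exists_eq_mk_of_mem_edgeFinset he
    have := ha.le_card fun b => g.adj_Y he h
    have := h4 (g.orig u) (g.orig v) (g.x s(u, v) u) (g.x s(u, v) v)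
    omega
  · have := nine_le_numColors hwt he
    obtain ⟨u, v, -, rfl⟩ := exists_eq_mk_of_mem_edgeFinset he
    have := ha.le_card fun b => g.adj_Z he h
    have := h4 (g.x s(u, v) u) (g.x s(u, v) v) (g.q s(u, v) 0) (g.q s(u, v) 1)
    omega
  · exact .inr ⟨e, he, .inr ⟨i, h⟩⟩

variable {g}

theorem adj_x_Y {e : Sym2 V} (he : e ∈ G.edgeFinset) {v : V} (hv : v ∈ e) {b : g.VH}
    (hb : b ∈ g.Y e) : g.H.Adj (g.x e v) b :=
  (g.adj_iff _ _).2 <| .inl <| .inr <| .inr <| .inr <| .inr <| .inl ⟨e, he, v, hv, rfl, .inl hb⟩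

theorem adj_x_Z {e : Sym2 V} (he : e ∈ G.edgeFinset) {v : V} (hv : v ∈ e) {b : g.VH}
    (hb : b ∈ g.Z e) : g.H.Adj (g.x e v) b :=
  (g.adj_iff _ _).2 <| .inl <| .inr <| .inr <| .inr <| .inr <| .inl
    ⟨e, he, v, hv, rfl, .inr <| .inl hb⟩

theorem adj_x_L {e : Sym2 V} (he : e ∈ G.edgeFinset) {v : V} (hv : v ∈ e) {b : g.VH}
    (hb : b ∈ g.L e v) : g.H.Adj (g.x e v) b :=
  (g.adj_iff _ _).2 <| .inl <| .inr <| .inr <| .inr <| .inr <| .inl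
    ⟨e, he, v, hv, rfl, .inr <| .inr hb⟩

theorem adj_q_Z {e : Sym2 V} (he : e ∈ G.edgeFinset) (i : Fin 2) {b : g.VH}
    (hb : b ∈ g.Z e) : g.H.Adj (g.q e i) b :=
  (g.adj_iff _ _).2 <| .inl <| .inr <| .inr <| .inr <| .inr <| .inr <| .inr
    ⟨e, he, i, rfl, .inl hb⟩

theorem adj_q_L {e : Sym2 V} (he : e ∈ G.edgeFinset) (i : Fin 2) {v : V} (hv : v ∈ e) {b : g.VH}
    (hb : b ∈ g.L e v) : g.H.Adj (g.q e i) b :=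
  (g.adj_iff _ _).2 <| .inl <| .inr <| .inr <| .inr <| .inr <| .inr <| .inr
    ⟨e, he, i, rfl, .inr <| .inl ⟨v, hv, hb⟩⟩

theorem adj_q_x {e : Sym2 V} (he : e ∈ G.edgeFinset) (i : Fin 2) {v : V} (hv : v ∈ e) :
    g.H.Adj (g.q e i) (g.x e v) :=
  (g.adj_iff _ _).2 <| .inl <| .inr <| .inr <| .inr <| .inr <| .inr <| .inr
    ⟨e, he, i, rfl, .inr <| .inr ⟨v, hv, rfl⟩⟩

theorem adj_q_q {e : Sym2 V} (he : e ∈ G.edgeFinset) {i j : Fin 2} (hij : i ≠ j) :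
    g.H.Adj (g.q e i) (g.q e j) := by
  have h : g.H.Adj (g.q e 0) (g.q e 1) :=
    (g.adj_iff _ _).2 <| .inl <| .inr <| .inr <| .inr <| .inr <| .inr <| .inl ⟨e, he, rfl, rfl⟩
  fin_cases i <;> fin_cases j <;> first | exact absurd rfl hij | exact h | exact h.symm

/-- The vertices `x_{e,u}`, `x_{e,v}`, `q_{e,h}` cannot be b-vertices of distinct colors. -/
theorem not_isBVertex_quad {c : g.VH → Fin (numColors G wt)}
    (hc : ∀ ⦃a b⦄, g.H.Adj a b → c a ≠ c b) {u v : V}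
    (he : s(u, v) ∈ G.edgeFinset) (huv : c (g.x s(u, v) u) ≠ c (g.x s(u, v) v))
    (hu : IsBVertex g.H c (g.x s(u, v) u)) (hv : IsBVertex g.H c (g.x s(u, v) v)) (i : Fin 2) :
    ¬ IsBVertex g.H c (g.q s(u, v) i) := by
  intro hq
  have key : ∀ a ∈ s(u, v), ∀ b ∈ s(u, v), c (g.x s(u, v) a) ≠ c (g.x s(u, v) b) →
      IsBVertex g.H c (g.x s(u, v) a) → ∃ l ∈ g.L s(u, v) a, c l = c (g.x s(u, v) b) := by
    intro a ha b hb hab h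
    obtain ⟨l, hl, hcl⟩ := h _ hab.symm
    rcases g.adj_x he ha hl with h | h | h | ⟨j, rfl⟩
    · exact absurd hcl.symm (hc (adj_x_Y he hb h))
    · exact absurd hcl.symm (hc (adj_x_Z he hb h))
    · exact ⟨l, h, hcl⟩
    · exact absurd hcl (hc (adj_q_x he j hb))
  have hmu : u ∈ s(u, v) := Sym2.mem_mk_left u v
  have hmv : v ∈ s(u, v) := Sym2.mem_mk_right u v
  obtain ⟨l, hl, hcl⟩ := key u hmu v hmv huv hu
  obtain ⟨l', hl', hcl'⟩ := key v hmv u hmu huv.symm hv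
  have hsub : univ.erase (c (g.q s(u, v) i)) ⊆
      (insert (g.q s(u, v) (1 - i)) (g.Z s(u, v) ∪ g.L s(u, v) u ∪ g.L s(u, v) v)).image c := by
    intro col hcol
    obtain ⟨b, hb, rfl⟩ := hq col (ne_of_mem_erase hcol)
    simp only [mem_image, mem_insert, mem_union]
    rcases g.adj_q he hb with ⟨j, hj, rfl⟩ | h | ⟨w, hw, h⟩ | ⟨w, hw, rfl⟩
    · have : j = 1 - i := by omega
      exact ⟨_, .inl rfl, by rw [this]⟩
    · exact ⟨b, by simp [h], rfl⟩
    · rcases Sym2.mem_iff.1 hw with rfl | rfl <;> exact ⟨b, by simp [h], rfl⟩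
    · rcases Sym2.mem_iff.1 hw with rfl | rfl
      · exact ⟨l', by simp [hl'], hcl'⟩
      · exact ⟨l, by simp [hl], hcl⟩
  have h1 := (card_le_card hsub).trans card_image_le
  rw [card_erase_of_mem (mem_univ _), card_univ, Fintype.card_fin] at h1
  have h2 := card_insert_le (g.q s(u, v) (1 - i)) (g.Z s(u, v) ∪ g.L s(u, v) u ∪ g.L s(u, v) v)
  have h3 := card_union_le (g.Z s(u, v) ∪ g.L s(u, v) u) (g.L s(u, v) v)
  have h4 := card_union_le (g.Z s(u, v)) (g.L s(u, v) u)
  have h5 := g.card_Z _ he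
  rw [g.card_L _ he _ hmu] at h4
  rw [g.card_L _ he _ hmv] at h3
  omega

/-- If `x_{e,u}` and some `q_{e,h}` are b-vertices, then the colors on `Y_e` occur on
`L_{e,v}`. -/
theorem image_Y_subset {c : g.VH → Fin (numColors G wt)}
    (hc : ∀ ⦃a b⦄, g.H.Adj a b → c a ≠ c b) {e : Sym2 V} (he : e ∈ G.edgeFinset) {u v : V}
    (hu : u ∈ e) (hv : v ∈ e) (huv : ∀ w ∈ e, w = u ∨ w = v) {i : Fin 2}
    (hx : IsBVertex g.H c (g.x e u)) (hq : IsBVertex g.H c (g.q e i)) :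
    (g.Y e).image c ⊆ (g.L e v).image c := by
  have hinj := hx.injOn (N := g.Y e ∪ g.Z e ∪ g.L e u ∪ univ.image (g.q e)) (by
      intro b hb
      simp only [mem_union, mem_image, mem_univ, true_and]
      rcases g.adj_x he hu hb with h | h | h | ⟨j, rfl⟩
      · simp [h]
      · simp [h]
      · simp [h]
      · exact .inr ⟨j, rfl⟩) (by
      have h1 := card_union_le (g.Y e ∪ g.Z e ∪ g.L e u) (univ.image (g.q e))
      have h2 := card_union_le (g.Y e ∪ g.Z e) (g.L e u)
      have h3 := card_union_le (g.Y e) (g.Z e)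
      have h4 : (univ.image (g.q e)).card ≤ _ := card_image_le
      rw [card_univ, Fintype.card_fin] at h4
      rw [g.card_Y e he] at h3
      rw [g.card_L e he u hu] at h2
      have h5 := g.card_Z e he
      omega)
  intro col hcol
  obtain ⟨y, hy, rfl⟩ := mem_image.1 hcol
  have hy' : y ∈ g.Y e ∪ g.Z e ∪ g.L e u ∪ univ.image (g.q e) := by simp [hy]
  have hne : ∀ b ∈ g.Y e ∪ g.Z e ∪ g.L e u ∪ univ.image (g.q e), g.kind b ≠ 7 → c b ≠ c y := by
    intro b hb hk h
    exact hk (hinj hb hy' h ▸ g.kind_Y he hy)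
  obtain ⟨b, hb, hbc⟩ := hq (c y) (hne _ (by simp) (by simp [g.kind_q he])).symm
  rcases g.adj_q he hb with ⟨j, hj, rfl⟩ | h | ⟨w, hw, h⟩ | ⟨w, hw, rfl⟩
  · exact absurd hbc (hne _ (by simp) (by simp [g.kind_q he]))
  · exact absurd hbc (hne _ (by simp [h]) (by simp [g.kind_Z he h]))
  · rcases huv w hw with rfl | rfl
    · exact absurd hbc (hne _ (by simp [h]) (by simp [g.kind_L he hw h]))
    · exact mem_image.2 ⟨b, h, hbc⟩
  · exact absurd hbc (hc (adj_x_Y he hw hy))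

theorem vertW_le_two_mul_outW {c : g.VH → Fin (numColors G wt)} {o : Sym2 V → V}
    (ho : ∀ e ∈ G.edgeFinset, (g.Y e).image c ⊆ (g.L e (o e)).image c) {v : V}
    (hv : IsBVertex g.H c (g.orig v)) : vertW G wt v ≤ 2 * outW G wt o v := by
  have hsub : univ.erase (c (g.orig v)) ⊆
      (g.P v ∪ (G.edgeFinset.filter (v ∈ ·)).biUnion (g.L · v) ∪
        (G.edgeFinset.filter (fun e => v ∈ e ∧ o e ≠ v)).biUnion g.Y).image c := by
    intro col hcol
    obtain ⟨b, hb, rfl⟩ := hv col (ne_of_mem_erase hcol)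
    simp only [mem_image, mem_union, mem_biUnion, mem_filter]
    rcases g.adj_orig hb with h | ⟨e, he, hve, h | h⟩
    · exact ⟨b, by simp [h], rfl⟩
    · exact ⟨b, .inl <| .inr ⟨e, ⟨he, hve⟩, h⟩, rfl⟩
    · by_cases hoe : o e = v
      · obtain ⟨l, hl, hlc⟩ := mem_image.1 (ho e he (mem_image_of_mem c h))
        exact ⟨l, .inl <| .inr ⟨e, ⟨he, hve⟩, hoe ▸ hl⟩, hlc⟩
      · exact ⟨b, .inr ⟨e, ⟨he, hve, hoe⟩, h⟩, rfl⟩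
  have h1 := (card_le_card hsub).trans card_image_le
  rw [card_erase_of_mem (mem_univ _), card_univ, Fintype.card_fin] at h1
  have h2 := (card_union_le _ _).trans' h1
  have h3 := card_union_le (g.P v) ((G.edgeFinset.filter (v ∈ ·)).biUnion (g.L · v))
  have h4 : ((G.edgeFinset.filter (v ∈ ·)).biUnion (g.L · v)).card ≤ vertW G wt v := by
    refine card_biUnion_le.trans (sum_le_sum fun e he => ?_)
    rw [mem_filter] at he
    exact (g.card_L e he.1 v he.2).le
  have h5 : ((G.edgeFinset.filter (fun e => v ∈ e ∧ o e ≠ v)).biUnion g.Y).card ≤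
      outW G wt o v := by
    refine card_biUnion_le.trans (sum_le_sum fun e he => ?_)
    rw [mem_filter] at he
    exact (g.card_Y e he.1).le
  have h6 := g.card_P v
  omega

/-- In a b-coloring, all copies of vertices of `G` are b-vertices, and for each edge
some `x_{e,u}` and some `q_{e,h}` are. -/
theorem isBVertex_of_isBColoring [Nonempty V] (hwt : ∀ e ∈ G.edgeFinset, 1 ≤ wt e)
    {c : g.VH → Fin (numColors G wt)} (hc : IsBColoring g.H (numColors G wt) c) :
    (∀ v, IsBVertex g.H c (g.orig v)) ∧ ∀ e ∈ G.edgeFinset,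
      (∃ u ∈ e, IsBVertex g.H c (g.x e u)) ∧ ∃ i, IsBVertex g.H c (g.q e i) := by
  obtain ⟨hproper, -, hb⟩ := hc
  choose r hrc hrb using hb
  have hrinj : Function.Injective r := fun i j h => by rw [← hrc i, h, hrc]
  have hR : ∀ a ∈ univ.image r, IsBVertex g.H c a := by
    simpa using hrb
  have hRc : ∀ a ∈ univ.image r, ∀ b ∈ univ.image r, c a = c b → a = b := by
    simp only [mem_image, mem_univ, true_and]
    rintro _ ⟨i, rfl⟩ _ ⟨j, rfl⟩ h
    rw [hrc, hrc] at h
    rw [h]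
  have hmiss : ∀ e ∈ G.edgeFinset, ∃ a ∈ g.quad e, a ∉ univ.image r := by
    intro e he
    by_contra! hall
    obtain ⟨u, v, huv, rfl⟩ := exists_eq_mk_of_mem_edgeFinset he
    have hmu : u ∈ s(u, v) := Sym2.mem_mk_left u v
    have hmv : v ∈ s(u, v) := Sym2.mem_mk_right u v
    have hu := hall _ (g.mem_quad.2 (.inl ⟨u, hmu, rfl⟩))
    have hv := hall _ (g.mem_quad.2 (.inl ⟨v, hmv, rfl⟩))
    have hq := hall _ (g.mem_quad.2 (.inr ⟨0, rfl⟩))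
    exact not_isBVertex_quad hproper he
      (fun h => huv (g.eq_of_x_eq he hmu he hmv (hRc _ hu _ hv h)).2)
      (hR _ hu) (hR _ hv) 0 (hR _ hq)
  have : Nonempty g.VH := ⟨g.sstar⟩
  choose! f hfq hfR using hmiss
  have hfinj : Set.InjOn f G.edgeFinset := fun e he e' he' h =>
    g.eq_of_mem_quad he he' (hfq e he) (h ▸ hfq e' he')
  have heq : univ.image r ∪ G.edgeFinset.image f = g.candidates := by
    apply eq_of_subset_of_card_le
    · intro a ha
      rcases mem_union.1 ha with ha | ha
      · exact g.isBVertex_mem_candidates hwt (hR a ha)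
      · obtain ⟨e, he, rfl⟩ := mem_image.1 ha
        exact mem_union_right _ (mem_biUnion.2 ⟨e, he, hfq e he⟩)
    · rw [card_union_of_disjoint, card_image_of_injective _ hrinj, card_image_of_injOn hfinj,
        card_univ, Fintype.card_fin]
      · exact g.card_candidates_le
      · rw [disjoint_right]
        intro a ha
        obtain ⟨e, he, rfl⟩ := mem_image.1 ha
        exact hfR e he
  have hcand : ∀ a ∈ g.candidates, IsBVertex g.H c a ∨ ∃ e ∈ G.edgeFinset, f e = a := by
    intro a ha
    rw [← heq, mem_union, mem_image (s := G.edgeFinset)] at ha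
    exact ha.imp_left (hR a)
  have hquad : ∀ e ∈ G.edgeFinset, ∀ a ∈ g.quad e, IsBVertex g.H c a ∨ f e = a := by
    intro e he a ha
    refine (hcand a (mem_union_right _ (mem_biUnion.2 ⟨e, he, ha⟩))).imp_right ?_
    rintro ⟨e', he', rfl⟩
    rw [g.eq_of_mem_quad he he' ha (hfq e' he')]
  refine ⟨fun v => ?_, fun e he => ⟨?_, ?_⟩⟩
  · refine (hcand (g.orig v) (by simp [candidates])).resolve_right ?_
    rintro ⟨e, he, h⟩
    exact g.orig_notMem_quad he v (h ▸ hfq e he)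
  · obtain ⟨u, v, huv, rfl⟩ := exists_eq_mk_of_mem_edgeFinset he
    have hmu : u ∈ s(u, v) := Sym2.mem_mk_left u v
    have hmv : v ∈ s(u, v) := Sym2.mem_mk_right u v
    rcases hquad _ he _ (g.mem_quad.2 (.inl ⟨u, hmu, rfl⟩)) with h | h
    · exact ⟨u, hmu, h⟩
    rcases hquad _ he _ (g.mem_quad.2 (.inl ⟨v, hmv, rfl⟩)) with h' | h'
    · exact ⟨v, hmv, h'⟩
    · exact absurd (g.eq_of_x_eq he hmu he hmv (h.symm.trans h')).2 huv
  · rcases hquad _ he _ (g.mem_quad.2 (.inr ⟨0, rfl⟩)) with h | h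
    · exact ⟨0, h⟩
    rcases hquad _ he _ (g.mem_quad.2 (.inr ⟨1, rfl⟩)) with h' | h'
    · exact ⟨1, h'⟩
    · exact absurd (g.eq_of_q_eq he he (h.symm.trans h')).2 (by decide)

theorem exists_isCirculating_of_isBColoring [Nonempty V] (hwt : ∀ e ∈ G.edgeFinset, 1 ≤ wt e)
    {c : g.VH → Fin (numColors G wt)} (hc : IsBColoring g.H (numColors G wt) c) :
    ∃ o : Sym2 V → V, IsCirculating G wt o := by
  obtain ⟨horig, hedge⟩ := isBVertex_of_isBColoring hwt hc
  have : ∀ e ∈ G.edgeFinset, ∃ v ∈ e, (g.Y e).image c ⊆ (g.L e v).image c := by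
    intro e he
    obtain ⟨⟨u, hu, hxu⟩, i, hq⟩ := hedge e he
    refine ⟨Sym2.Mem.other hu, Sym2.other_mem hu,
      image_Y_subset hc.1 he hu (Sym2.other_mem hu) (fun w hw => ?_) hxu hq⟩
    rwa [← Sym2.other_spec hu, Sym2.mem_iff] at hw
  choose! o ho hsub using this
  exact ⟨o, isCirculating_of_vertW_le G wt ho fun v => vertW_le_two_mul_outW hsub (horig v)⟩

end Gadget

/-- Finsets of equal size admit a bijection sending a given subset into a given large
enough subset. -/
theorem exists_image_eq_of_card_eq {α β : Type*} [DecidableEq α] [DecidableEq β] [Nonempty β]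
    {S S' : Finset α} {T T' : Finset β} (h : S.card = T.card) (hS : S' ⊆ S) (hT : T' ⊆ T)
    (h' : S'.card ≤ T'.card) : ∃ f : α → β, S.image f = T ∧ ∀ a ∈ S', f a ∈ T' := by
  have key : ∀ (A : Finset α) (B : Finset β), A.card = B.card → ∃ f : α → β, A.image f = B := by
    intro A B hAB
    let φ := equivOfCardEq hAB
    refine ⟨fun a => if ha : a ∈ A then φ ⟨a, ha⟩ else Classical.arbitrary β, ?_⟩
    ext b
    simp only [mem_image]
    constructor
    · rintro ⟨a, ha, rfl⟩
      simp [ha]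
    · intro hb
      exact ⟨φ.symm ⟨b, hb⟩, by simp, by simp⟩
  obtain ⟨U, hUT, hU⟩ := exists_subset_card_eq h'
  obtain ⟨f, hf⟩ := key S' U hU.symm
  obtain ⟨f', hf'⟩ := key (S \ S') (T \ U) (by
    rw [card_sdiff_of_subset hS, card_sdiff_of_subset (hUT.trans hT), h, hU])
  have hin : ∀ a ∈ S', f a ∈ U := fun a ha => hf ▸ mem_image_of_mem f ha
  refine ⟨fun a => if a ∈ S' then f a else f' a, ?_, fun a ha => ?_⟩
  · rw [← union_sdiff_of_subset hS, image_union, ← union_sdiff_of_subset (hUT.trans hT)]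
    congr 1
    · rw [← hf]
      exact image_congr fun a ha => if_pos ha
    · rw [← hf']
      exact image_congr fun a ha => if_neg (mem_sdiff.1 ha).2
  · simpa [ha] using hUT (hin a ha)

namespace Gadget

attribute [local instance] GadgetData.fintypeVH GadgetData.decEqVH

variable {G : SimpleGraph V} [DecidableRel G.Adj] {wt : Sym2 V → ℕ} (g : Gadget V G wt)

/-- A function on the vertices of `H` may be prescribed independently on all parts. -/
theorem exists_coloring {α : Type*} (star : α) (fS anon : g.VH → α) (fA : g.VH → g.VH → α)
    (vert : V → α) (fP : V → g.VH → α) (fX : Sym2 V → α) (fY fZ : Sym2 V → g.VH → α)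
    (fQ : Sym2 V → Fin 2 → α) :
    ∃ c : g.VH → α, c g.sstar = star ∧ (∀ a ∈ g.Sleaves, c a = fS a) ∧
      (∀ s ∈ g.Acenters, c s = anon s) ∧ (∀ s ∈ g.Acenters, ∀ a ∈ g.Aleaves s, c a = fA s a) ∧
      (∀ v, c (g.orig v) = vert v) ∧ (∀ v, ∀ a ∈ g.P v, c a = fP v a) ∧
      (∀ e ∈ G.edgeFinset, ∀ v ∈ e, c (g.x e v) = fX e) ∧
      (∀ e ∈ G.edgeFinset, ∀ a ∈ g.Y e, c a = fY e a) ∧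
      (∀ e ∈ G.edgeFinset, ∀ a ∈ g.Z e, c a = fZ e a) ∧
      (∀ e ∈ G.edgeFinset, ∀ i, c (g.q e i) = fQ e i) := by
  have key : ∀ a : g.VH, ∃ col : α, (a = g.sstar → col = star) ∧ (a ∈ g.Sleaves → col = fS a) ∧
      (a ∈ g.Acenters → col = anon a) ∧ (∀ s ∈ g.Acenters, a ∈ g.Aleaves s → col = fA s a) ∧
      (∀ v, a = g.orig v → col = vert v) ∧ (∀ v, a ∈ g.P v → col = fP v a) ∧
      (∀ e ∈ G.edgeFinset, ∀ v ∈ e, a = g.x e v → col = fX e) ∧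
      (∀ e ∈ G.edgeFinset, a ∈ g.Y e → col = fY e a) ∧
      (∀ e ∈ G.edgeFinset, a ∈ g.Z e → col = fZ e a) ∧
      (∀ e ∈ G.edgeFinset, ∀ i, a = g.q e i → col = fQ e i) := by
    intro a
    have hi := g.orig_inj
    have hcol : ∃ col : α, (a = g.sstar ∧ col = star) ∨ (a ∈ g.Sleaves ∧ col = fS a) ∨
        (a ∈ g.Acenters ∧ col = anon a) ∨ (∃ s ∈ g.Acenters, a ∈ g.Aleaves s ∧ col = fA s a) ∨
        (∃ v, a = g.orig v ∧ col = vert v) ∨ (∃ v, a ∈ g.P v ∧ col = fP v a) ∨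
        (∃ e ∈ G.edgeFinset, ∃ v ∈ e, a = g.x e v ∧ col = fX e) ∨
        (∃ e ∈ G.edgeFinset, a ∈ g.Y e ∧ col = fY e a) ∨
        (∃ e ∈ G.edgeFinset, a ∈ g.Z e ∧ col = fZ e a) ∨
        (∃ e ∈ G.edgeFinset, ∃ i, a = g.q e i ∧ col = fQ e i) := by
      have := g.cases_vertex a
      grind
    obtain ⟨col, hcol⟩ := hcol
    obtain ⟨n, hn⟩ : ∃ n, g.kind a = n := ⟨_, rfl⟩
    refine ⟨col, ?_⟩
    rcases hcol with h | h | h | h | h | h | h | h | h | h <;>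
    grind [kind_sstar, kind_Sleaves, kind_Acenters, kind_Aleaves, kind_orig, kind_P, kind_x,
      kind_Y, kind_Z, kind_q, eq_of_mem_P, eq_of_mem_Y, eq_of_mem_Z, eq_of_mem_Aleaves,
      eq_of_x_eq, eq_of_q_eq, Function.Injective]
  choose c h0 h1 h2 h3 h4 h5 h6 h7 h8 h9 using key
  exact ⟨c, h0 _ rfl, h1, h2, fun s hs a => h3 a s hs, fun v => h4 _ v rfl, fun v a => h5 a v,
    fun e he v hv => h6 _ e he v hv rfl, fun e he a => h7 a e he, fun e he a => h8 a e he,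
    fun e he i => h9 _ e he i rfl⟩

variable {g}

/-- A sufficient condition for a coloring of `H` to be a b-coloring; here `o` is an
orientation and `N` is the set of colors allowed on the sets `L_{e,v}`. -/
theorem isBColoring_of_colors {c : g.VH → Fin (numColors G wt)} {o : Sym2 V → V}
    {N : Finset (Fin (numColors G wt))}
    (ho : ∀ e ∈ G.edgeFinset, o e ∈ e)
    (hS : ∀ col, (∃ a ∈ g.Sleaves, c a = col) ↔ col ≠ c g.sstar)
    (hA : ∀ s ∈ g.Acenters, ∀ col, (∃ a ∈ g.Aleaves s, c a = col) ↔ col ≠ c s)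
    (hL : ∀ e ∈ G.edgeFinset, ∀ v ∈ e, ∀ a ∈ g.L e v, c a ∈ N)
    (hvN : ∀ v, c (g.orig v) ∉ N)
    (hxN : ∀ e ∈ G.edgeFinset, ∀ v ∈ e, c (g.x e v) ∉ N)
    (hqN : ∀ e ∈ G.edgeFinset, ∀ i, c (g.q e i) ∉ N)
    (hxx : ∀ e ∈ G.edgeFinset, ∀ u ∈ e, ∀ v ∈ e, c (g.x e u) = c (g.x e v))
    (hxq : ∀ e ∈ G.edgeFinset, ∀ v ∈ e, ∀ i, c (g.x e v) ≠ c (g.q e i))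
    (hqq : ∀ e ∈ G.edgeFinset, c (g.q e 0) ≠ c (g.q e 1))
    (hY : ∀ e ∈ G.edgeFinset, ∀ col, (∃ a ∈ g.Y e, c a = col) ↔ ∃ a ∈ g.L e (o e), c a = col)
    (hZ : ∀ e ∈ G.edgeFinset, ∀ col, (∃ a ∈ g.Z e, c a = col) ↔
      (∀ v ∈ e, ∀ a ∈ g.L e v, c a ≠ col) ∧ (∀ v ∈ e, c (g.x e v) ≠ col) ∧
        ∀ i, c (g.q e i) ≠ col)
    (hP : ∀ v col, (∃ a ∈ g.P v, c a = col) ↔ c (g.orig v) ≠ col ∧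
      (∀ e ∈ G.edgeFinset, v ∈ e → ∀ a ∈ g.L e v, c a ≠ col) ∧
      (∀ e ∈ G.edgeFinset, v ∈ e → o e ≠ v → ∀ a ∈ g.L e (o e), c a ≠ col))
    (hcover : ∀ col, col = c g.sstar ∨ (∃ s ∈ g.Acenters, col = c s) ∨ (∃ v, col = c (g.orig v)) ∨
      ∃ e ∈ G.edgeFinset, (∀ v ∈ e, col = c (g.x e v)) ∨ ∃ i, col = c (g.q e i)) :
    IsBColoring g.H (numColors G wt) c := by
  have hproper : ∀ a b, g.AdjSpec a b → c a ≠ c b := by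
    intro a b h
    rcases h with ⟨rfl, h⟩ | ⟨s, hs, rfl, h⟩ | ⟨v, rfl, h⟩ | ⟨e, he, v, hv, rfl, h | h⟩ |
      ⟨e, he, v, hv, rfl, h | h | h⟩ | ⟨e, he, rfl, rfl⟩ | ⟨e, he, i, rfl, h | ⟨v, hv, h⟩ | ⟨v, hv, rfl⟩⟩
    · exact ((hS _).1 ⟨b, h, rfl⟩).symm
    · exact ((hA _ hs _).1 ⟨b, h, rfl⟩).symm
    · exact ((hP _ _).1 ⟨b, h, rfl⟩).1
    · exact fun hc => hvN v (hc ▸ hL e he v hv b h)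
    · obtain ⟨l, hl, hlc⟩ := (hY e he _).1 ⟨b, h, rfl⟩
      exact fun hc => hvN v (hc ▸ hlc ▸ hL e he _ (ho e he) l hl)
    · obtain ⟨l, hl, hlc⟩ := (hY e he _).1 ⟨b, h, rfl⟩
      exact fun hc => hxN e he v hv (hc ▸ hlc ▸ hL e he _ (ho e he) l hl)
    · exact ((hZ e he _).1 ⟨b, h, rfl⟩).2.1 v hv
    · exact fun hc => hxN e he v hv (hc ▸ hL e he v hv b h)
    · exact hqq e he
    · exact ((hZ e he _).1 ⟨b, h, rfl⟩).2.2 i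
    · exact fun hc => hqN e he i (hc ▸ hL e he v hv b h)
    · exact (hxq e he v hv i).symm
  have hb : ∀ col : Fin (numColors G wt), ∃ a : g.VH, c a = col ∧ IsBVertex g.H c a := by
    intro col
    rcases hcover col with rfl | ⟨s, hs, rfl⟩ | ⟨v, rfl⟩ | ⟨e, he, hcol | ⟨i, rfl⟩⟩
    · refine ⟨_, rfl, fun col hcol => ?_⟩
      obtain ⟨a, ha, h⟩ := (hS col).2 hcol
      exact ⟨a, (g.adj_iff _ _).2 <| .inl <| .inl ⟨rfl, ha⟩, h⟩
    · refine ⟨_, rfl, fun col hcol => ?_⟩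
      obtain ⟨a, ha, h⟩ := (hA s hs col).2 hcol
      exact ⟨a, (g.adj_iff _ _).2 <| .inl <| .inr <| .inl ⟨s, hs, rfl, ha⟩, h⟩
    · refine ⟨_, rfl, fun col hcol => ?_⟩
      by_cases h : ∃ a ∈ g.P v, c a = col
      · obtain ⟨a, ha, h⟩ := h
        exact ⟨a, (g.adj_iff _ _).2 <| .inl <| .inr <| .inr <| .inl ⟨v, rfl, ha⟩, h⟩
      rw [hP] at h
      have h' : (∃ e ∈ G.edgeFinset, v ∈ e ∧ ∃ a ∈ g.L e v, c a = col) ∨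
          ∃ e ∈ G.edgeFinset, v ∈ e ∧ ∃ a ∈ g.L e (o e), c a = col := by
        grind
      rcases h' with ⟨e, he, hv, a, ha, h⟩ | ⟨e, he, hv, h⟩
      · exact ⟨a, (g.adj_iff _ _).2 <| .inl <| .inr <| .inr <| .inr <| .inl
          ⟨e, he, v, hv, rfl, .inl ha⟩, h⟩
      · obtain ⟨a, ha, h⟩ := (hY e he col).2 h
        exact ⟨a, (g.adj_iff _ _).2 <| .inl <| .inr <| .inr <| .inr <| .inl
          ⟨e, he, v, hv, rfl, .inr ha⟩, h⟩
    · have hv := ho e he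
      have hu := Sym2.other_mem hv
      have huv : ∀ w ∈ e, w = o e ∨ w = Sym2.Mem.other hv := by
        intro w hw
        rwa [← Sym2.other_spec hv, Sym2.mem_iff] at hw
      refine ⟨g.x e (Sym2.Mem.other hv), (hcol _ hu).symm, fun col hcol => ?_⟩
      by_cases h : ∃ a ∈ g.Z e, c a = col
      · obtain ⟨a, ha, h⟩ := h
        exact ⟨a, adj_x_Z he hu ha, h⟩
      by_cases hq : ∃ i, c (g.q e i) = col
      · obtain ⟨i, hi⟩ := hq
        exact ⟨_, (adj_q_x he i hu).symm, hi⟩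
      have hx : ∀ v ∈ e, c (g.x e v) ≠ col := fun v hv => by
        rw [hxx e he v hv _ hu]
        exact hcol.symm
      rw [hZ e he] at h
      have h' : ∃ v ∈ e, ∃ a ∈ g.L e v, c a = col := by
        push Not at hq
        by_contra! hno
        exact h ⟨hno, hx, hq⟩
      obtain ⟨w, hw, a, ha, h⟩ := h'
      rcases huv w hw with rfl | rfl
      · obtain ⟨a, ha, h⟩ := (hY e he col).2 ⟨a, ha, h⟩
        exact ⟨a, adj_x_Y he hu ha, h⟩
      · exact ⟨a, adj_x_L he hu ha, h⟩
    · refine ⟨_, rfl, fun col hcol => ?_⟩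
      by_cases h : ∃ a ∈ g.Z e, c a = col
      · obtain ⟨a, ha, h⟩ := h
        exact ⟨a, adj_q_Z he i ha, h⟩
      by_cases hq : ∃ j, c (g.q e j) = col
      · obtain ⟨j, rfl⟩ := hq
        exact ⟨_, adj_q_q he (fun h => hcol (h ▸ rfl)), rfl⟩
      by_cases hx : ∃ v ∈ e, c (g.x e v) = col
      · obtain ⟨v, hv, hx⟩ := hx
        exact ⟨_, adj_q_x he i hv, hx⟩
      rw [hZ e he] at h
      have h' : ∃ v ∈ e, ∃ a ∈ g.L e v, c a = col := by
        push Not at hq hx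
        by_contra! hno
        exact h ⟨hno, hx, hq⟩
      obtain ⟨w, hw, a, ha, h⟩ := h'
      exact ⟨a, adj_q_L he i hw ha, h⟩
  refine ⟨fun a b h => ?_, fun col => ?_, hb⟩
  · rcases (g.adj_iff a b).1 h with h | h
    · exact hproper a b h
    · exact (hproper b a h).symm
  · obtain ⟨a, ha, -⟩ := hb col
    exact ⟨a, ha⟩

variable (g)

theorem card_biUnion_L {F : Finset (Sym2 V)} (hF : F ⊆ G.edgeFinset) {h : Sym2 V → V}
    (hh : ∀ e ∈ F, h e ∈ e) : (F.biUnion fun e => g.L e (h e)).card = ∑ e ∈ F, wt e := by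
  rw [card_biUnion]
  · exact sum_congr rfl fun e he => g.card_L e (hF he) _ (hh e he)
  · intro e he e' he' hne
    exact g.L_disjoint e (hF he) _ (hh e he) e' (hF he') _ (hh e' he') (by simp [hne])

/-- The set of all vertices in the sets `L_{e,v}`. -/
def allL : Finset g.VH :=
  univ.biUnion fun v => (G.edgeFinset.filter (v ∈ ·)).biUnion (g.L · v)

theorem L_subset_allL {e : Sym2 V} (he : e ∈ G.edgeFinset) {v : V} (hv : v ∈ e) :
    g.L e v ⊆ g.allL := fun _ ha =>
  mem_biUnion.2 ⟨v, mem_univ v, mem_biUnion.2 ⟨e, mem_filter.2 ⟨he, hv⟩, ha⟩⟩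

theorem allL_subset : g.allL ⊆ g.Sleaves := by
  intro a ha
  simp only [allL, mem_biUnion, mem_filter] at ha
  obtain ⟨v, -, e, ⟨he, hv⟩, ha⟩ := ha
  exact g.L_subset e he v hv ha

theorem card_allL_le : g.allL.card ≤ 2 * totW G wt := by
  rw [← sum_vertW]
  refine card_biUnion_le.trans (sum_le_sum fun v _ => ?_)
  exact (g.card_biUnion_L (filter_subset _ _) (h := fun _ => v) fun e he =>
    (mem_filter.1 he).2).le

/-- The vertices of the construction receiving a color of their own, with `x_{e,u}` and
`x_{e,v}` identified, are as many as the colors. -/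
theorem exists_palette : ∃ (star : Fin (numColors G wt)) (anon : g.VH → Fin (numColors G wt))
    (vert : V → Fin (numColors G wt)) (edge : Sym2 V → Fin 3 → Fin (numColors G wt)),
    Set.InjOn anon g.Acenters ∧ (∀ s ∈ g.Acenters, anon s ≠ star) ∧
    (∀ s ∈ g.Acenters, ∀ v, anon s ≠ vert v) ∧
    (∀ s ∈ g.Acenters, ∀ e ∈ G.edgeFinset, ∀ i, anon s ≠ edge e i) ∧
    (∀ e ∈ G.edgeFinset, Function.Injective (edge e)) ∧
    ∀ col, col = star ∨ (∃ s ∈ g.Acenters, col = anon s) ∨ (∃ v, col = vert v) ∨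
      ∃ e ∈ G.edgeFinset, ∃ i, col = edge e i := by
  obtain ⟨φ⟩ : Nonempty (Option (g.Acenters ⊕ V ⊕ (G.edgeFinset × Fin 3)) ≃
      Fin (numColors G wt)) := by
    refine ⟨Fintype.equivOfCardEq ?_⟩
    simp only [Fintype.card_option, Fintype.card_sum, Fintype.card_prod, Fintype.card_coe,
      Fintype.card_fin, g.card_Acenters]
    rw [numColors]
    ring
  refine ⟨φ none, fun s => if hs : s ∈ g.Acenters then φ (some (.inl ⟨s, hs⟩)) else φ none,
    fun v => φ (some (.inr (.inl v))),
    fun e i => if he : e ∈ G.edgeFinset then φ (some (.inr (.inr (⟨e, he⟩, i)))) else φ none,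
    ?_, ?_, ?_, ?_, ?_, ?_⟩
  · intro s hs s' hs' h
    rw [mem_coe] at hs hs'
    simpa [hs, hs'] using h
  · intro s hs
    simp [hs]
  · intro s hs v
    simp [hs]
  · intro s hs e he i
    simp only [hs, he, dite_true]
    simp
  · intro e he i j h
    simp only [he, dite_true] at h
    simpa using h
  · intro col
    obtain ⟨z, rfl⟩ := φ.surjective col
    rcases z with - | ⟨s, hs⟩ | v | ⟨⟨e, he⟩, i⟩
    · exact .inl rfl
    · exact .inr <| .inl ⟨s, hs, by simp [hs]⟩
    · exact .inr <| .inr <| .inl ⟨v, rfl⟩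
    · exact .inr <| .inr <| .inr ⟨e, he, i, by simp only [he, dite_true]⟩

theorem exists_isBColoring_of_isCirculating {o : Sym2 V → V} (ho : IsCirculating G wt o) :
    ∃ c : g.VH → Fin (numColors G wt), IsBColoring g.H (numColors G wt) c := by
  obtain ⟨hoe, hcirc⟩ := ho
  obtain ⟨star, anon, vert, edge, hanon, hstar, hvert, hedge, hinj, hcover⟩ := g.exists_palette
  have : Nonempty (Fin (numColors G wt)) := ⟨star⟩
  set N := g.Acenters.image anon with hN
  obtain ⟨fS, hfS, hfL⟩ := exists_image_eq_of_card_eq (S := g.Sleaves) (S' := g.allL)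
    (T := univ.erase star) (T' := N)
    (by rw [g.card_Sleaves, card_erase_of_mem (mem_univ _), card_univ, Fintype.card_fin])
    g.allL_subset
    (by
      intro col hcol
      obtain ⟨s, hs, rfl⟩ := mem_image.1 hcol
      exact mem_erase.2 ⟨hstar s hs, mem_univ _⟩)
    (by
      rw [hN, card_image_of_injOn hanon, g.card_Acenters]
      exact g.card_allL_le.trans (Nat.le_succ _))
  have hfSinj : Set.InjOn fS g.Sleaves := by
    rw [← card_image_iff, hfS, g.card_Sleaves, card_erase_of_mem (mem_univ _), card_univ,
      Fintype.card_fin]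
  have hLinj : ∀ B ⊆ g.allL, (B.image fS).card = B.card := fun B hB =>
    card_image_of_injOn (hfSinj.mono (coe_subset.2 (hB.trans g.allL_subset)))
  have hLN : ∀ B ⊆ g.allL, B.image fS ⊆ N := fun B hB =>
    image_subset_iff.2 fun a ha => hfL a (hB ha)
  have hout : ∀ v, vertW G wt v = 2 * outW G wt o v := by
    intro v
    have h1 : inW G wt o v = outW G wt o v := hcirc v
    have h2 := inW_add_outW G wt o v
    omega
  have hexA : ∀ s ∈ g.Acenters, ∃ f : g.VH → Fin (numColors G wt),
      (g.Aleaves s).image f = univ.erase (anon s) := by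
    intro s hs
    obtain ⟨f, hf, -⟩ := exists_image_eq_of_card_eq (S := g.Aleaves s) (S' := ∅)
      (T := univ.erase (anon s)) (T' := ∅)
      (by rw [g.card_Aleaves s hs, card_erase_of_mem (mem_univ _), card_univ, Fintype.card_fin])
      (empty_subset _) (empty_subset _) le_rfl
    exact ⟨f, hf⟩
  have hexY : ∀ e ∈ G.edgeFinset, ∃ f : g.VH → Fin (numColors G wt),
      (g.Y e).image f = (g.L e (o e)).image fS := by
    intro e he
    obtain ⟨f, hf, -⟩ := exists_image_eq_of_card_eq (S := g.Y e) (S' := ∅)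
      (T := (g.L e (o e)).image fS) (T' := ∅)
      (by rw [hLinj _ (g.L_subset_allL he (hoe e he)), g.card_L e he _ (hoe e he), g.card_Y e he])
      (empty_subset _) (empty_subset _) le_rfl
    exact ⟨f, hf⟩
  have hexZ : ∀ e ∈ G.edgeFinset, ∃ f : g.VH → Fin (numColors G wt),
      (g.Z e).image f =
        (((univ.filter (· ∈ e)).biUnion (g.L e)).image fS ∪ univ.image (edge e))ᶜ := by
    intro e he
    have hsub : (univ.filter (· ∈ e)).biUnion (g.L e) ⊆ g.allL :=
      biUnion_subset.2 fun v hv => g.L_subset_allL he (mem_filter.1 hv).2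
    have hd : Disjoint (((univ.filter (· ∈ e)).biUnion (g.L e)).image fS)
        (univ.image (edge e)) := by
      rw [disjoint_left]
      intro col hcol hcol'
      obtain ⟨s, hs, rfl⟩ := mem_image.1 (hLN _ hsub hcol)
      obtain ⟨i, -, h⟩ := mem_image.1 hcol'
      exact hedge s hs e he i h.symm
    have hcard : ((univ.filter (· ∈ e)).biUnion (g.L e)).card = 2 * wt e := by
      rw [card_biUnion, sum_congr rfl fun v hv => g.card_L e he v (mem_filter.1 hv).2, sum_const,
        card_filter_mem_edge he, smul_eq_mul]
      intro v hv v' hv' hne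
      exact g.L_disjoint e he v (mem_filter.1 hv).2 e he v' (mem_filter.1 hv').2 (by simp [hne])
    obtain ⟨f, hf, -⟩ := exists_image_eq_of_card_eq (S := g.Z e) (S' := ∅)
      (T := (((univ.filter (· ∈ e)).biUnion (g.L e)).image fS ∪ univ.image (edge e))ᶜ) (T' := ∅)
      (by
        rw [card_compl, card_union_of_disjoint hd, hLinj _ hsub, hcard,
          card_image_of_injective _ (hinj e he), card_univ, Fintype.card_fin, Fintype.card_fin]
        have := g.card_Z e he
        omega)
      (empty_subset _) (empty_subset _) le_rfl
    exact ⟨f, hf⟩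
  have hexP : ∀ v, ∃ f : g.VH → Fin (numColors G wt), (g.P v).image f =
      (insert (vert v) (((G.edgeFinset.filter (v ∈ ·)).biUnion (g.L · v) ∪
        (G.edgeFinset.filter (fun e => v ∈ e ∧ o e ≠ v)).biUnion
          fun e => g.L e (o e)).image fS))ᶜ := by
    intro v
    set B := (G.edgeFinset.filter (v ∈ ·)).biUnion (g.L · v)
    set B' := (G.edgeFinset.filter (fun e => v ∈ e ∧ o e ≠ v)).biUnion fun e => g.L e (o e)
    have hB : B.card = vertW G wt v := g.card_biUnion_L (filter_subset _ _) (h := fun _ => v)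
      fun e he => (mem_filter.1 he).2
    have hB' : B'.card = outW G wt o v := g.card_biUnion_L (filter_subset _ _) (h := o)
      fun e he => hoe e (mem_filter.1 he).1
    have hd : Disjoint B B' := by
      rw [disjoint_left]
      intro a ha ha'
      obtain ⟨e, he, hae⟩ := mem_biUnion.1 ha
      obtain ⟨e', he', hae'⟩ := mem_biUnion.1 ha'
      rw [mem_filter] at he he'
      obtain ⟨rfl, h⟩ := g.eq_of_mem_L he.1 he.2 he'.1 (hoe _ he'.1) hae hae'
      exact he'.2.2 h.symm
    have hsub : B ∪ B' ⊆ g.allL := union_subset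
      (biUnion_subset.2 fun e he => g.L_subset_allL (mem_filter.1 he).1 (mem_filter.1 he).2)
      (biUnion_subset.2 fun e he =>
        g.L_subset_allL (mem_filter.1 he).1 (hoe e (mem_filter.1 he).1))
    have hv : vert v ∉ (B ∪ B').image fS := by
      intro h
      obtain ⟨s, hs, h⟩ := mem_image.1 (hLN _ hsub h)
      exact hvert s hs v h
    obtain ⟨f, hf, -⟩ := exists_image_eq_of_card_eq (S := g.P v) (S' := ∅)
      (T := (insert (vert v) ((B ∪ B').image fS))ᶜ) (T' := ∅)
      (by
        rw [card_compl, card_insert_of_notMem hv, hLinj _ hsub, card_union_of_disjoint hd, hB,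
          hB', Fintype.card_fin]
        have := g.card_P v
        have := hout v
        omega)
      (empty_subset _) (empty_subset _) le_rfl
    exact ⟨f, hf⟩
  have : Nonempty g.VH := ⟨g.sstar⟩
  choose! fA hfA using hexA
  choose! fY hfY using hexY
  choose! fZ hfZ using hexZ
  choose fP hfP using hexP
  obtain ⟨c, c0, c1, c2, c3, c4, c5, c6, c7, c8, c9⟩ := g.exists_coloring star fS anon fA vert fP
    (fun e => edge e 0) fY fZ (fun e i => edge e i.succ)
  have cL : ∀ e ∈ G.edgeFinset, ∀ v ∈ e, ∀ a ∈ g.L e v, c a = fS a := fun e he v hv a ha =>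
    c1 a (g.L_subset e he v hv ha)
  have hex : ∀ {S : Finset g.VH} {f : g.VH → Fin (numColors G wt)} {T}, S.image f = T →
      (∀ a ∈ S, c a = f a) → ∀ col, (∃ a ∈ S, c a = col) ↔ col ∈ T := by
    rintro S f T rfl h col
    rw [mem_image]
    exact exists_congr fun a => and_congr_right fun ha => by rw [h a ha]
  refine ⟨c, isBColoring_of_colors (o := o) (N := N) hoe ?_ ?_ ?_ ?_ ?_ ?_ ?_ ?_ ?_ ?_ ?_ ?_ ?_⟩
  · intro col
    rw [hex hfS c1, c0]
    simp
  · intro s hs col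
    rw [hex (hfA s hs) (c3 s hs), c2 s hs]
    simp
  · intro e he v hv a ha
    rw [cL e he v hv a ha]
    exact hfL a (g.L_subset_allL he hv ha)
  · intro v h
    rw [c4] at h
    obtain ⟨s, hs, h⟩ := mem_image.1 h
    exact hvert s hs v h
  · intro e he v hv h
    rw [c6 e he v hv] at h
    obtain ⟨s, hs, h⟩ := mem_image.1 h
    exact hedge s hs e he 0 h
  · intro e he i h
    rw [c9 e he] at h
    obtain ⟨s, hs, h⟩ := mem_image.1 h
    exact hedge s hs e he _ h
  · intro e he u hu v hv
    rw [c6 e he u hu, c6 e he v hv]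
  · intro e he v hv i
    rw [c6 e he v hv, c9 e he]
    exact (hinj e he).ne (Fin.succ_ne_zero i).symm
  · intro e he
    rw [c9 e he, c9 e he]
    exact (hinj e he).ne (by decide)
  · intro e he col
    rw [hex (hfY e he) (c7 e he), hex rfl (cL e he _ (hoe e he))]
  · intro e he col
    rw [hex (hfZ e he) (c8 e he)]
    simp only [mem_compl, mem_union, mem_image, mem_biUnion, mem_filter, mem_univ, true_and,
      Fin.exists_fin_succ (n := 2), not_or, not_exists, not_and]
    constructor
    · rintro ⟨hl, hx, hq⟩
      refine ⟨fun v hv a ha => ?_, fun v hv => ?_, fun i => ?_⟩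
      · rw [cL e he v hv a ha]
        exact hl a ⟨v, hv, ha⟩
      · rwa [c6 e he v hv]
      · rw [c9 e he]
        exact hq i
    · rintro ⟨hl, hx, hq⟩
      refine ⟨?_, ?_, fun i => ?_⟩
      · rintro a ⟨v, hv, ha⟩
        rw [← cL e he v hv a ha]
        exact hl v hv a ha
      · rw [← c6 e he _ (hoe e he)]
        exact hx _ (hoe e he)
      · rw [← c9 e he]
        exact hq i
  · intro v col
    rw [hex (hfP v) (c5 v), c4]
    simp only [mem_compl, mem_insert, mem_union, mem_image, mem_biUnion, mem_filter, not_or,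
      not_exists, not_and]
    refine and_congr (not_congr eq_comm) ⟨fun h => ⟨fun e he hv a ha => ?_,
      fun e he hv hne a ha => ?_⟩, ?_⟩
    · rw [cL e he v hv a ha]
      exact h a (.inl ⟨e, ⟨he, hv⟩, ha⟩)
    · rw [cL e he _ (hoe e he) a ha]
      exact h a (.inr ⟨e, ⟨he, hv, hne⟩, ha⟩)
    · rintro ⟨h, h'⟩ a (⟨e, ⟨he, hv⟩, ha⟩ | ⟨e, ⟨he, hv, hne⟩, ha⟩)
      · rw [← cL e he v hv a ha]
        exact h e he hv a ha
      · rw [← cL e he _ (hoe e he) a ha]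
        exact h' e he hv hne a ha
  · intro col
    rcases hcover col with rfl | ⟨s, hs, rfl⟩ | ⟨v, rfl⟩ | ⟨e, he, i, rfl⟩
    · exact .inl c0.symm
    · exact .inr <| .inl ⟨s, hs, (c2 s hs).symm⟩
    · exact .inr <| .inr <| .inl ⟨v, (c4 v).symm⟩
    · refine .inr <| .inr <| .inr ⟨e, he, ?_⟩
      cases i using Fin.cases with
      | zero => exact .inl fun v hv => (c6 e he v hv).symm
      | succ i => exact .inr ⟨i, (c9 e he i).symm⟩

end Gadget

/-- `(G, wt)` admits a circulating orientation if and only if the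
constructed graph `H` admits a b-coloring with `k = 2W + 3m + n + 2` colors. -/
theorem circulating_orientation_iff_bColoring
    {V : Type*} [Fintype V] [DecidableEq V] (G : SimpleGraph V) [DecidableRel G.Adj]
    (wt : Sym2 V → ℕ) (hconn : G.Connected)
    (hwt : ∀ e ∈ G.edgeFinset, 1 ≤ wt e)
    (heven : ∀ v : V, Even (vertW G wt v))
    (g : Gadget V G wt) :
    (∃ o : Sym2 V → V, IsCirculating G wt o) ↔
      ∃ c : g.VH → Fin (numColors G wt), IsBColoring g.H (numColors G wt) c := by
  have := hconn.nonempty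
  exact ⟨fun ⟨_, ho⟩ => g.exists_isBColoring_of_isCirculating ho,
    fun ⟨_, hc⟩ => Gadget.exists_isCirculating_of_isBColoring hwt hc⟩
end
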